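/- arXiv:1108.0637 — 2 statements merged into one kernel-verified Lean document; each statement's English description precedes it below -/
import Mathlib

section
/- Let Ω ⊂ ℝ³ be a bounded open set with smooth boundary which is star-shaped with respect to the origin (x·n(x) ≥ 0 on ∂Ω, where n is the outward unit normal), let q > 0 and λ ≤ 0. Then the system −Δu = λu + q|u|³u·φ, −Δφ = q|u|⁵ in Ω with u = φ = 0 on ∂Ω has no nontrivial classical solution, i.e. every pair (u, φ) of functions C² on Ω and C¹ on the closed domain satisfying the system pointwise and vanishing on ∂Ω must satisfy u ≡ 0 and φ ≡ 0. -/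
open Metric Real Set

noncomputable section

/-- Euclidean 3-space. -/
abbrev E3 := EuclideanSpace ℝ (Fin 3)

/-- The Laplace operator on functions `ℝ³ → ℝ`. -/
def lap (f : E3 → ℝ) (x : E3) : ℝ :=
  ∑ i : Fin 3, fderiv ℝ (fun y => fderiv ℝ f y (EuclideanSpace.single i 1)) x
    (EuclideanSpace.single i 1)

open MeasureTheory Filter Topology

/-- The `i`-th partial derivative. -/
def pd (i : Fin 3) (f : E3 → ℝ) (x : E3) : ℝ := fderiv ℝ f x (EuclideanSpace.single i 1)

lemma lap_eq_sum_pd (f : E3 → ℝ) (x : E3) : lap f x = ∑ i, pd i (pd i f) x := rfl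

lemma pd_congr {f g : E3 → ℝ} {x : E3} (h : f =ᶠ[𝓝 x] g) (i : Fin 3) : pd i f x = pd i g x := by
  simp [pd, h.fderiv_eq]

lemma pd_eventuallyEq {f g : E3 → ℝ} {x : E3} (h : f =ᶠ[𝓝 x] g) (i : Fin 3) :
    pd i f =ᶠ[𝓝 x] pd i g :=
  h.eventually_nhds.mono fun _ hy => pd_congr hy i

lemma lap_congr {f g : E3 → ℝ} {x : E3} (h : f =ᶠ[𝓝 x] g) : lap f x = lap g x := by
  simp only [lap_eq_sum_pd]
  exact Finset.sum_congr rfl fun i _ => pd_congr (pd_eventuallyEq h i) i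

lemma contDiffOn_pd {u : E3 → ℝ} {Ω : Set E3} (hΩ : IsOpen Ω) (hu : ContDiffOn ℝ 2 u Ω)
    (i : Fin 3) : ContDiffOn ℝ 1 (pd i u) Ω :=
  (hu.fderiv_of_isOpen hΩ (by norm_num)).clm_apply contDiffOn_const

lemma continuousOn_fderiv {u : E3 → ℝ} {Ω : Set E3} (hΩ : IsOpen Ω) (hu : ContDiffOn ℝ 1 u Ω) :
    ContinuousOn (fderiv ℝ u) Ω :=
  hu.continuousOn_fderiv_of_isOpen hΩ (by norm_num)

lemma continuousOn_pd {u : E3 → ℝ} {Ω : Set E3} (hΩ : IsOpen Ω) (hu : ContDiffOn ℝ 1 u Ω)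
    (i : Fin 3) : ContinuousOn (pd i u) Ω :=
  (continuousOn_fderiv hΩ hu).clm_apply continuousOn_const

lemma continuousOn_lap {u : E3 → ℝ} {Ω : Set E3} (hΩ : IsOpen Ω) (hu : ContDiffOn ℝ 2 u Ω) :
    ContinuousOn (lap u) Ω := by
  have h : ContinuousOn (fun x => ∑ i, pd i (pd i u) x) Ω :=
    continuousOn_finsetSum _ fun i _ => continuousOn_pd hΩ (contDiffOn_pd hΩ hu i) i
  exact h

lemma abs_pd_le (u : E3 → ℝ) (x : E3) (i : Fin 3) : |pd i u x| ≤ ‖fderiv ℝ u x‖ := by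
  simpa [pd] using (fderiv ℝ u x).le_opNorm (EuclideanSpace.single i (1 : ℝ))

lemma pd_add_const_mul {f g : E3 → ℝ} {x : E3} (hf : DifferentiableAt ℝ f x)
    (hg : DifferentiableAt ℝ g x) (c : ℝ) (i : Fin 3) :
    pd i (fun y => f y + c * g y) x = pd i f x + c * pd i g x := by
  have h := (hf.hasFDerivAt.add (hg.hasFDerivAt.const_mul c)).fderiv
  have h' : fderiv ℝ (fun y => f y + c * g y) x = fderiv ℝ f x + c • fderiv ℝ g x := h
  simp [pd, h']

lemma pd_mul {f g : E3 → ℝ} {x : E3} (hf : DifferentiableAt ℝ f x)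
    (hg : DifferentiableAt ℝ g x) (i : Fin 3) :
    pd i (fun y => f y * g y) x = f x * pd i g x + g x * pd i f x := by
  simp [pd, fderiv_fun_mul hf hg]

lemma lap_add_const_mul {f g : E3 → ℝ} {W : Set E3} (hW : IsOpen W) (hf : ContDiffOn ℝ 2 f W)
    (hg : ContDiffOn ℝ 2 g W) (c : ℝ) {x : E3} (hx : x ∈ W) :
    lap (fun y => f y + c * g y) x = lap f x + c * lap g x := by
  have d : ∀ {k : E3 → ℝ} {y : E3}, ContDiffOn ℝ 1 k W → y ∈ W → DifferentiableAt ℝ k y :=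
    fun hk hy => (hk.differentiableOn (by norm_num)).differentiableAt (hW.mem_nhds hy)
  have h12 : (1 : WithTop ℕ∞) ≤ 2 := by norm_num
  simp only [lap_eq_sum_pd, Finset.mul_sum, ← Finset.sum_add_distrib]
  refine Finset.sum_congr rfl fun i _ => ?_
  have h : pd i (fun y => f y + c * g y) =ᶠ[𝓝 x] fun y => pd i f y + c * pd i g y := by
    filter_upwards [hW.mem_nhds hx] with y hy
    exact pd_add_const_mul (d (hf.of_le h12) hy) (d (hg.of_le h12) hy) c i
  rw [pd_congr h, pd_add_const_mul (d (contDiffOn_pd hW hf i) hx) (d (contDiffOn_pd hW hg i) hx)]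

lemma hasFDerivAt_coord (i : Fin 3) (x : E3) :
    HasFDerivAt (fun y : E3 => y i) (EuclideanSpace.proj (𝕜 := ℝ) i : E3 →L[ℝ] ℝ) x :=
  (EuclideanSpace.proj (𝕜 := ℝ) i : E3 →L[ℝ] ℝ).hasFDerivAt

lemma pd_norm_sub_sq (p x : E3) (i : Fin 3) :
    pd i (fun y => ‖y - p‖ ^ 2) x = 2 * (x i - p i) := by
  have h := (((hasFDerivAt_id x).sub_const p).norm_sq).fderiv
  have h' : fderiv ℝ (fun y : E3 => ‖y - p‖ ^ 2) x = _ := h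
  simp [pd, h', EuclideanSpace.inner_single_right]

lemma pd_coord_sub (p x : E3) (i : Fin 3) : pd i (fun y => y i - p i) x = 1 := by
  have h := ((hasFDerivAt_coord i x).sub_const (p i)).fderiv
  simp [pd, h]

lemma contDiff_norm_sub_sq (p : E3) : ContDiff ℝ 2 (fun y : E3 => ‖y - p‖ ^ 2) :=
  (contDiff_id.sub contDiff_const).norm_sq ℝ

lemma lap_norm_sub_sq (p x : E3) : lap (fun y => ‖y - p‖ ^ 2) x = 6 := by
  have h : ∀ i : Fin 3, pd i (pd i fun y => ‖y - p‖ ^ 2) x = 2 := by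
    intro i
    have e : pd i (fun y => ‖y - p‖ ^ 2) = fun y => (0 : ℝ) + 2 * (y i - p i) := by
      ext y
      rw [pd_norm_sub_sq, zero_add]
    rw [e, pd_add_const_mul (differentiableAt_const _)
      ((hasFDerivAt_coord i x).sub_const (p i)).differentiableAt, pd_coord_sub]
    simp [pd]
  rw [lap_eq_sum_pd, Finset.sum_congr rfl fun i _ => h i]
  norm_num

lemma contDiffOn_inv_norm_sub_sq (p : E3) :
    ContDiffOn ℝ 2 (fun y : E3 => (‖y - p‖ ^ 2)⁻¹) {p}ᶜ :=
  (contDiff_norm_sub_sq p).contDiffOn.inv fun x hx => by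
    simpa [sub_eq_zero] using hx

lemma lap_inv_norm_sub_sq {p x : E3} (hx : x ≠ p) :
    lap (fun y => (‖y - p‖ ^ 2)⁻¹) x = 2 * ((‖x - p‖ ^ 2)⁻¹) ^ 2 := by
  have hne : ∀ y : E3, y ≠ p → ‖y - p‖ ^ 2 ≠ 0 := fun y hy => by
    simpa [sub_eq_zero] using hy
  have dsq : ∀ y : E3, DifferentiableAt ℝ (fun y : E3 => ‖y - p‖ ^ 2) y := fun y =>
    ((contDiff_norm_sub_sq p).differentiable (by norm_num)) y
  have dinv : ∀ y : E3, y ≠ p → DifferentiableAt ℝ (fun y : E3 => (‖y - p‖ ^ 2)⁻¹) y :=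
    fun y hy => (dsq y).inv (hne y hy)
  have h1 : ∀ (i : Fin 3) (y : E3), y ≠ p →
      pd i (fun y => (‖y - p‖ ^ 2)⁻¹) y
        = -2 * (((‖y - p‖ ^ 2)⁻¹ * (‖y - p‖ ^ 2)⁻¹) * (y i - p i)) := by
    intro i y hy
    have e := ((hasDerivAt_inv (hne y hy)).comp_hasFDerivAt y (dsq y).hasFDerivAt).fderiv
    have e' : fderiv ℝ (fun y : E3 => (‖y - p‖ ^ 2)⁻¹) y = _ := e
    have e2 := pd_norm_sub_sq p y i
    simp only [pd] at e2 ⊢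
    rw [e']
    simp only [_root_.smul_apply, smul_eq_mul, e2]
    field_simp
  have h2 : ∀ i : Fin 3, pd i (pd i fun y => (‖y - p‖ ^ 2)⁻¹) x
      = -2 * ((‖x - p‖ ^ 2)⁻¹) ^ 2 + 8 * ((‖x - p‖ ^ 2)⁻¹) ^ 3 * (x i - p i) ^ 2 := by
    intro i
    have e : pd i (fun y => (‖y - p‖ ^ 2)⁻¹) =ᶠ[𝓝 x] fun y =>
        (0 : ℝ) + (-2) * (((‖y - p‖ ^ 2)⁻¹ * (‖y - p‖ ^ 2)⁻¹) * (y i - p i)) := by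
      filter_upwards [isOpen_compl_singleton.mem_nhds hx] with y hy
      rw [h1 i y hy, zero_add]
    have dc : DifferentiableAt ℝ (fun y : E3 => y i - p i) x :=
      ((hasFDerivAt_coord i x).sub_const (p i)).differentiableAt
    have dii : DifferentiableAt ℝ (fun y : E3 => (‖y - p‖ ^ 2)⁻¹ * (‖y - p‖ ^ 2)⁻¹) x :=
      (dinv x hx).mul (dinv x hx)
    have diic : DifferentiableAt ℝ
        (fun y : E3 => ((‖y - p‖ ^ 2)⁻¹ * (‖y - p‖ ^ 2)⁻¹) * (y i - p i)) x := dii.mul dc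
    rw [pd_congr e, pd_add_const_mul (differentiableAt_const _) diic, pd_mul dii dc,
      pd_mul (dinv x hx) (dinv x hx), h1 i x hx, pd_coord_sub]
    have : pd i (fun _ => (0 : ℝ)) x = 0 := by simp [pd]
    rw [this]
    ring
  rw [lap_eq_sum_pd, Finset.sum_congr rfl fun i _ => h2 i]
  have hs : ‖x - p‖ ^ 2 = ∑ i : Fin 3, (x i - p i) ^ 2 := by
    rw [EuclideanSpace.norm_sq_eq]
    simp
  rw [Finset.sum_add_distrib, ← Finset.mul_sum _ _ (8 * _), ← hs]
  have := hne x hx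
  simp only [Finset.sum_const, Finset.card_univ, Fintype.card_fin, nsmul_eq_mul]
  field_simp
  norm_num

lemma pd_pd_nonneg_of_isLocalMin {w : E3 → ℝ} {W : Set E3} (hW : IsOpen W)
    (hw : ContDiffOn ℝ 2 w W) {y : E3} (hy : y ∈ W) (hmin : IsLocalMin w y) (i : Fin 3) :
    0 ≤ pd i (pd i w) y := by
  by_contra! hneg
  set e : E3 := EuclideanSpace.single i (1 : ℝ) with he
  have line : ∀ t : ℝ, HasDerivAt (fun t : ℝ => y + t • e) e t := fun t => by
    simpa using ((hasDerivAt_id t).smul_const e).const_add y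
  have cont : Continuous fun t : ℝ => y + t • e := by fun_prop
  have h0 : y + (0 : ℝ) • e = y := by simp
  have tend : Tendsto (fun t : ℝ => y + t • e) (𝓝 0) (𝓝 y) := by
    simpa using cont.tendsto 0
  have along : ∀ {k : E3 → ℝ} {t : ℝ}, ContDiffOn ℝ 1 k W → y + t • e ∈ W →
      HasDerivAt (fun t : ℝ => k (y + t • e)) (pd i k (y + t • e)) t := by
    intro k t hk ht
    have hd := ((hk.differentiableOn (by norm_num)).differentiableAt (hW.mem_nhds ht)).hasFDerivAt
    exact hd.comp_hasDerivAt t (line t)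
  have hev : ∀ᶠ t in 𝓝 (0 : ℝ), y + t • e ∈ W := tend (hW.mem_nhds hy)
  have hd1 : deriv (fun t : ℝ => w (y + t • e)) =ᶠ[𝓝 0] fun t => pd i w (y + t • e) := by
    filter_upwards [hev] with t ht
    exact (along (hw.of_le (by norm_num)) ht).deriv
  have hd2 : deriv (deriv fun t : ℝ => w (y + t • e)) 0 = pd i (pd i w) y := by
    rw [hd1.deriv_eq, (along (contDiffOn_pd hW hw i) (by rwa [h0])).deriv, h0]
  have hlm : IsLocalMin (fun t : ℝ => w (y + t • e)) 0 := by
    have := tend.eventually hmin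
    simpa [IsLocalMin, IsMinFilter] using this
  have hlM : IsLocalMax (fun t : ℝ => w (y + t • e)) 0 :=
    isLocalMax_of_deriv_deriv_neg (by rw [hd2]; exact hneg) hlm.deriv_eq_zero
      (along (hw.of_le (by norm_num)) (by rwa [h0])).continuousAt
  have hconst : (fun t : ℝ => w (y + t • e)) =ᶠ[𝓝 0] fun _ => w (y + (0 : ℝ) • e) := by
    filter_upwards [hlm, hlM] with t h1 h2 using le_antisymm h2 h1
  have : deriv (deriv fun t : ℝ => w (y + t • e)) 0 = 0 := by
    rw [hconst.deriv.deriv_eq]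
    simp
  rw [hd2] at this
  exact hneg.ne this

/-- A strictly superharmonic function is nonnegative if it is nonnegative on the boundary. -/
lemma nonneg_of_lap_neg {w : E3 → ℝ} {W : Set E3} (hW : IsOpen W) (hb : Bornology.IsBounded W)
    (hc : ContinuousOn w (closure W)) (hw : ContDiffOn ℝ 2 w W) (hlap : ∀ x ∈ W, lap w x < 0)
    (hfr : ∀ x ∈ frontier W, 0 ≤ w x) : ∀ x ∈ W, 0 ≤ w x := by
  intro x hx
  by_contra! hneg
  obtain ⟨y, hy, hmin⟩ := (hb.isCompact_closure).exists_isMinOn ⟨x, subset_closure hx⟩ hc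
  have hyx : w y ≤ w x := hmin (subset_closure hx)
  have hyW : y ∈ W := by
    by_contra h
    have := hfr y ⟨hy, by rwa [hW.interior_eq]⟩
    linarith
  have hloc : IsLocalMin w y := hmin.isLocalMin (mem_of_superset (hW.mem_nhds hyW) subset_closure)
  have := hlap y hyW
  rw [lap_eq_sum_pd] at this
  exact this.not_ge (Finset.sum_nonneg fun i _ => pd_pd_nonneg_of_isLocalMin hW hw hyW hloc i)

lemma nonneg_of_lap_nonpos {w : E3 → ℝ} {W : Set E3} (hW : IsOpen W) (hb : Bornology.IsBounded W)
    (hc : ContinuousOn w (closure W)) (hw : ContDiffOn ℝ 2 w W) (hlap : ∀ x ∈ W, lap w x ≤ 0)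
    (hfr : ∀ x ∈ frontier W, 0 ≤ w x) : ∀ x ∈ W, 0 ≤ w x := by
  obtain ⟨R, hR⟩ := hb.closure.subset_closedBall 0
  have hR' : ∀ y ∈ closure W, ‖y - 0‖ ^ 2 ≤ R ^ 2 := fun y hy => by
    have := hR hy
    rw [mem_closedBall_zero_iff] at this
    rw [sub_zero]
    gcongr
  intro x hx
  have key : ∀ ε : ℝ, 0 < ε → 0 ≤ (w x + ε * R ^ 2) + (-ε) * ‖x - 0‖ ^ 2 := by
    intro ε hε
    have cd : ContDiffOn ℝ 2 (fun y => w y + ε * R ^ 2) W := hw.add contDiffOn_const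
    have cn := (contDiff_norm_sub_sq (0 : E3))
    refine nonneg_of_lap_neg (w := fun y => (w y + ε * R ^ 2) + (-ε) * ‖y - 0‖ ^ 2) hW hb
      ((hc.add continuousOn_const).add (continuousOn_const.mul cn.continuous.continuousOn))
      (cd.add (contDiffOn_const.mul cn.contDiffOn)) (fun y hy => ?_) (fun y hy => ?_) x hx
    · rw [lap_add_const_mul hW cd cn.contDiffOn (-ε) hy, lap_norm_sub_sq]
      have e : lap (fun y => w y + ε * R ^ 2) y = lap w y := by
        have := lap_add_const_mul hW hw (contDiffOn_const (c := R ^ 2)) ε hy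
        rw [this]
        simp [lap]
      rw [e]
      linarith [hlap y hy]
    · have h1 := hfr y hy
      have h2 := hR' y (frontier_subset_closure hy)
      nlinarith
  by_contra! hneg
  have hpos : 0 < R ^ 2 + 1 := by positivity
  have := key (-w x / (2 * (R ^ 2 + 1))) (div_pos (by linarith) (by positivity))
  have e : -w x / (2 * (R ^ 2 + 1)) * (2 * (R ^ 2 + 1)) = - w x := by field_simp
  have hεpos : 0 < -w x / (2 * (R ^ 2 + 1)) := div_pos (by linarith) (by positivity)
  nlinarith [sq_nonneg ‖x - 0‖, mul_nonneg hεpos.le (sq_nonneg ‖x - 0‖)]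

/-- Quantitative Hopf boundary lemma on a ball. -/
lemma hopf_ball {f : E3 → ℝ} {p : E3} {R : ℝ} (hR : 0 < R) (hc : Continuous f)
    (hf : ContDiffOn ℝ 2 f (ball p R)) (hlap : ∀ x ∈ ball p R, lap f x ≤ 0)
    (hpos : ∀ x ∈ ball p R, 0 < f x) (hnn : ∀ x, 0 ≤ f x) :
    ∃ c > 0, ∀ y ∈ sphere p R, ∀ t ∈ Icc (1 / 2 : ℝ) 1, c * (1 - t) ≤ f (p + t • (y - p)) := by
  have hne : (sphere p (R / 2)).Nonempty := NormedSpace.sphere_nonempty.2 (by positivity)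
  obtain ⟨z, hz, hzmin⟩ := (isCompact_sphere p (R / 2)).exists_isMinOn hne hc.continuousOn
  have hm : 0 < f z := hpos z (sphere_subset_ball (by linarith) hz)
  set m := f z
  set W : Set E3 := ball p R \ closedBall p (R / 2) with hWdef
  have hW : IsOpen W := isOpen_ball.sdiff isClosed_closedBall
  have hWb : Bornology.IsBounded W := isBounded_ball.subset sdiff_subset
  have hWcl : ∀ x ∈ closure W, R / 2 ≤ ‖x - p‖ ∧ ‖x - p‖ ≤ R := by
    have hn : Continuous fun x : E3 => ‖x - p‖ := by fun_prop
    have hcl : IsClosed {x : E3 | R / 2 ≤ ‖x - p‖ ∧ ‖x - p‖ ≤ R} :=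
      (isClosed_le continuous_const hn).inter (isClosed_le hn continuous_const)
    refine fun x hx => closure_minimal (fun x hx => ?_) hcl hx
    simp only [hWdef, Set.mem_sdiff, mem_ball, mem_closedBall, dist_eq_norm, not_le] at hx
    exact ⟨hx.2.le, hx.1.le⟩
  have hWp : closure W ⊆ {p}ᶜ := by
    intro x hx hxp
    have := (hWcl x hx).1
    rw [mem_singleton_iff.1 hxp] at this
    simp at this
    linarith
  set c : ℝ := m * R ^ 2 / 4 with hcdef
  have hcpos : 0 < c := by positivity
  have cdh : ContDiffOn ℝ 2 (fun y : E3 => (‖y - p‖ ^ 2)⁻¹) W :=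
    (contDiffOn_inv_norm_sub_sq p).mono (subset_closure.trans hWp)
  have cdf : ContDiffOn ℝ 2 (fun y => f y + c * (R ^ 2)⁻¹) W :=
    (hf.mono sdiff_subset).add contDiffOn_const
  have hW0 : ∀ x ∈ W, 0 ≤ (f x + c * (R ^ 2)⁻¹) + (-c) * (‖x - p‖ ^ 2)⁻¹ := by
    refine nonneg_of_lap_neg (w := fun y => (f y + c * (R ^ 2)⁻¹) + (-c) * (‖y - p‖ ^ 2)⁻¹) hW hWb
      ((hc.continuousOn.add continuousOn_const).add (continuousOn_const.mul
        ((contDiffOn_inv_norm_sub_sq p).continuousOn.mono hWp)))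
      (cdf.add (contDiffOn_const.mul cdh)) (fun y hy => ?_) (fun y hy => ?_)
    · have hyp : y ≠ p := hWp (subset_closure hy)
      rw [lap_add_const_mul hW cdf cdh (-c) hy, lap_inv_norm_sub_sq hyp]
      have e : lap (fun y => f y + c * (R ^ 2)⁻¹) y = lap f y := by
        have := lap_add_const_mul hW (hf.mono sdiff_subset) (contDiffOn_const (c := (R ^ 2)⁻¹)) c hy
        rw [this]
        simp [lap]
      rw [e]
      have h1 := hlap y hy.1
      have h2 : 0 < ‖y - p‖ := norm_pos_iff.2 (sub_ne_zero.2 hyp)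
      have h3 : 0 < c * (2 * ((‖y - p‖ ^ 2)⁻¹) ^ 2) := by positivity
      linarith
    · have hb := hWcl y (frontier_subset_closure hy)
      have hyn : y ∉ W := by
        have := hy.2
        rwa [hW.interior_eq] at this
      rcases hb.2.lt_or_eq with hlt | heq
      · have hh : ‖y - p‖ = R / 2 := by
          by_contra hne
          refine hyn ⟨by simpa [dist_eq_norm] using hlt, ?_⟩
          simp only [mem_closedBall, dist_eq_norm, not_le]
          exact lt_of_le_of_ne hb.1 (Ne.symm hne)
        have : m ≤ f y := hzmin (by simpa [dist_eq_norm] using hh)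
        rw [hh]
        have e : c * (R ^ 2)⁻¹ - c * ((R / 2) ^ 2)⁻¹ = - (3 / 4 * m) := by
          rw [hcdef]
          field_simp
          ring
        linarith
      · rw [heq]
        linarith [hnn y]
  refine ⟨c * (R ^ 2)⁻¹, by positivity, fun y hy t ht => ?_⟩
  have hyn : ‖y - p‖ = R := by simpa [dist_eq_norm] using hy
  have ht0 : 0 < t := by linarith [ht.1]
  have hnorm : ‖p + t • (y - p) - p‖ = t * R := by
    rw [add_sub_cancel_left, norm_smul, hyn, Real.norm_of_nonneg ht0.le]
  rcases ht.2.lt_or_eq with hlt | heq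
  · rcases ht.1.lt_or_eq with hgt | heq
    · have := hW0 (p + t • (y - p)) ⟨by
        rw [mem_ball, dist_eq_norm, hnorm]; nlinarith, by
        rw [mem_closedBall, dist_eq_norm, hnorm]; nlinarith⟩
      rw [hnorm] at this
      have h1 : 1 + (1 - t) ≤ (t ^ 2)⁻¹ := by
        rw [← one_div, le_div_iff₀ (by positivity)]
        nlinarith [mul_pos (sub_pos.2 hlt) (sub_pos.2 hlt), mul_pos ht0 (sub_pos.2 hlt)]
      have h2 : c * ((t * R) ^ 2)⁻¹ = c * (R ^ 2)⁻¹ * (t ^ 2)⁻¹ := by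
        rw [mul_pow, mul_inv]; ring
      have h3 : 0 < c * (R ^ 2)⁻¹ := by positivity
      nlinarith
    · have : m ≤ f (p + t • (y - p)) := hzmin (by
        rw [mem_sphere, dist_eq_norm, hnorm, ← heq]; ring)
      rw [← heq] at this ⊢
      have e : c * (R ^ 2)⁻¹ = m / 4 := by
        rw [hcdef]; field_simp
      rw [e]
      linarith
  · rw [heq]
    simpa using hnn y

lemma integrableOn_of_bound {f : E3 → ℝ} {Ω : Set E3} (hΩ : IsOpen Ω)
    (hb : Bornology.IsBounded Ω) (hf : ContinuousOn f Ω) {C : ℝ} (hC : ∀ x ∈ Ω, |f x| ≤ C) :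
    IntegrableOn f Ω := by
  have hfin : IsFiniteMeasure (volume.restrict Ω) := ⟨by simpa using hb.measure_lt_top⟩
  exact (integrable_const C).mono' (hf.aestronglyMeasurable hΩ.measurableSet)
    ((ae_restrict_iff' hΩ.measurableSet).2 (Eventually.of_forall hC))

lemma integral_pd_eq_zero {w : E3 → ℝ} (hw : ContDiff ℝ 1 w) (hs : HasCompactSupport w)
    (i : Fin 3) : ∫ x, pd i w x = 0 := by
  have hcont : Continuous (pd i w) := by
    simpa [continuousOn_univ] using continuousOn_pd isOpen_univ hw.contDiffOn i
  have hcs : HasCompactSupport (pd i w) := hs.fderiv_apply ℝ (EuclideanSpace.single i (1 : ℝ))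
  have hi : Integrable fun x => fderiv ℝ w x (EuclideanSpace.single i 1) :=
    hcont.integrable_of_hasCompactSupport hcs
  have h := integral_mul_fderiv_eq_neg_fderiv_mul_of_integrable (μ := (volume : Measure E3))
    (f := fun _ : E3 => (1 : ℝ)) (g := w) (v := EuclideanSpace.single i (1 : ℝ))
    (by simp) (by simpa using hi)
    (by simpa using hw.continuous.integrable_of_hasCompactSupport hs)
    (fun x _ => differentiableAt_const _) (fun x _ => hw.differentiable (by norm_num) x)
  simpa [pd] using h

/-- A smooth truncation vanishing near `0` and equal to the identity far away. -/
lemma exists_truncation : ∃ (h : ℝ → ℝ) (C : ℝ), ContDiff ℝ 1 h ∧ (∀ t, |t| ≤ 1 → h t = 0) ∧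
    (∀ t, |deriv h t| ≤ C) ∧ (∀ t, 2 ≤ |t| → h t = t ∧ deriv h t = 1) ∧ (∀ t, |h t| ≤ |t|) := by
  set h : ℝ → ℝ := fun t => t * smoothTransition (t ^ 2 - 1) with hdef
  have hcd : ContDiff ℝ 1 h :=
    contDiff_id.mul (smoothTransition.contDiff.comp ((contDiff_id.pow 2).sub contDiff_const))
  have hid : ∀ t, 3 / 2 < |t| → h t = t := by
    intro t ht
    have : 1 ≤ t ^ 2 - 1 := by
      rw [← sq_abs]
      nlinarith
    simp [hdef, smoothTransition.one_of_one_le this]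
  have hd1 : ∀ t, 2 ≤ |t| → deriv h t = 1 := by
    intro t ht
    have ho : IsOpen {t : ℝ | 3 / 2 < |t|} := isOpen_lt continuous_const continuous_abs
    have : h =ᶠ[𝓝 t] id := by
      filter_upwards [ho.mem_nhds (show 3 / 2 < |t| by linarith)] with s hs using hid s hs
    rw [this.deriv_eq, deriv_id]
  obtain ⟨C, hC⟩ := (isCompact_Icc (a := (-2 : ℝ)) (b := 2)).exists_bound_of_continuousOn
    (hcd.continuous_deriv (by norm_num)).continuousOn
  refine ⟨h, max C 1, hcd, fun t ht => ?_, fun t => ?_, fun t ht => ⟨hid t (by linarith), hd1 t ht⟩,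
    fun t => ?_⟩
  · have : t ^ 2 - 1 ≤ 0 := by
      rw [← sq_abs]
      nlinarith [abs_nonneg t]
    simp [hdef, smoothTransition.zero_of_nonpos this]
  · rcases le_total 2 |t| with h2 | h2
    · rw [hd1 t h2]
      simp
    · exact (hC t (abs_le.1 h2)).trans (le_max_left _ _)
  · rw [hdef, abs_mul]
    have h1 := smoothTransition.le_one (t ^ 2 - 1)
    have h0 := smoothTransition.nonneg (t ^ 2 - 1)
    rw [abs_of_nonneg h0]
    nlinarith [abs_nonneg t]

/-- The gradient vanishes almost everywhere on the zero set. -/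
lemma ae_pd_eq_zero_of_eq_zero {v : E3 → ℝ} {Ω : Set E3} (hΩ : IsOpen Ω) (hv : Continuous v)
    (hd : DifferentiableOn ℝ v Ω) :
    ∀ᵐ x ∂volume.restrict Ω, v x = 0 → ∀ i, pd i v x = 0 := by
  set s : Set E3 := Ω ∩ v ⁻¹' {0} with hs
  have hsm : MeasurableSet s :=
    hΩ.measurableSet.inter (hv.measurable (measurableSet_singleton 0))
  set e : E3 := EuclideanSpace.single 0 (1 : ℝ) with he
  have hF : ApproximatesLinearOn (fun x => v x • e) (0 : E3 →L[ℝ] E3) s 0 := by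
    intro x hx y hy
    have h1 : v x = 0 := hx.2
    have h2 : v y = 0 := hy.2
    simp [h1, h2]
  have hF' : ∀ x ∈ s, HasFDerivWithinAt (fun x => v x • e) ((fderiv ℝ v x).smulRight e) s x := by
    intro x hx
    exact (((hd.differentiableAt (hΩ.mem_nhds hx.1)).hasFDerivAt).smul_const e).hasFDerivWithinAt
  have h := hF.norm_fderiv_sub_le volume hsm _ hF'
  rw [ae_restrict_iff' hsm] at h
  rw [ae_restrict_iff' hΩ.measurableSet]
  filter_upwards [h] with x hx hxΩ hvx i
  have h0 := hx ⟨hxΩ, hvx⟩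
  simp only [sub_zero, nonpos_iff_eq_zero, nnnorm_eq_zero] at h0
  have h1 := congrArg (fun A : E3 →L[ℝ] E3 => A (EuclideanSpace.single i 1)) h0
  have h2 : e ≠ 0 := by simp [he]
  simpa [pd, h2] using h1

/-- Green's formula on an arbitrary bounded open set, for a test function vanishing outside. -/
lemma green {u v : E3 → ℝ} {Ω : Set E3} (hΩ : IsOpen Ω) (hb : Bornology.IsBounded Ω)
    (hu : ContDiffOn ℝ 2 u Ω) {L M L' : ℝ} (hL : ∀ x ∈ Ω, ‖fderiv ℝ u x‖ ≤ L)
    (hM : ∀ x ∈ Ω, |lap u x| ≤ M) (hv : Continuous v) (hv0 : ∀ x ∉ Ω, v x = 0)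
    (hv1 : ContDiffOn ℝ 1 v Ω) (hL' : ∀ x ∈ Ω, ‖fderiv ℝ v x‖ ≤ L') :
    ∫ x in Ω, ∑ i, pd i v x * pd i u x = -∫ x in Ω, v x * lap u x := by
  obtain ⟨h, C, hcd, hz, hC, hid, hle⟩ := exists_truncation
  have hC0 : 0 ≤ C := (abs_nonneg _).trans (hC 0)
  obtain ⟨V, hV⟩ := (hb.isCompact_closure).exists_bound_of_continuousOn hv.continuousOn
  have hV' : ∀ x ∈ Ω, |v x| ≤ V := fun x hx => hV x (subset_closure hx)
  have hdv : ∀ x ∈ Ω, DifferentiableAt ℝ v x := fun x hx =>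
    (hv1.differentiableOn (by norm_num)).differentiableAt (hΩ.mem_nhds hx)
  have hdpu : ∀ i, ∀ x ∈ Ω, DifferentiableAt ℝ (pd i u) x := fun i x hx =>
    ((contDiffOn_pd hΩ hu i).differentiableOn (by norm_num)).differentiableAt (hΩ.mem_nhds hx)
  have hgrad : ∀ x ∈ Ω, |∑ i, pd i v x * pd i u x| ≤ 3 * (L' * L) := by
    intro x hx
    refine (Finset.abs_sum_le_sum_abs _ _).trans ?_
    refine (Finset.sum_le_card_nsmul _ _ (L' * L) fun i _ => ?_).trans (by simp)
    rw [abs_mul]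
    exact mul_le_mul ((abs_pd_le v x i).trans (hL' x hx)) ((abs_pd_le u x i).trans (hL x hx))
      (abs_nonneg _) ((norm_nonneg _).trans (hL' x hx))
  have hgc : ContinuousOn (fun x => ∑ i, pd i v x * pd i u x) Ω :=
    continuousOn_finsetSum _ fun i _ =>
      (continuousOn_pd hΩ hv1 i).mul (contDiffOn_pd hΩ hu i).continuousOn
  have hlc : ContinuousOn (fun x => v x * lap u x) Ω :=
    hv.continuousOn.mul (continuousOn_lap hΩ hu)
  have hlb : ∀ x ∈ Ω, |v x * lap u x| ≤ V * M := by
    intro x hx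
    rw [abs_mul]
    exact mul_le_mul (hV' x hx) (hM x hx) (abs_nonneg _) ((abs_nonneg _).trans (hV' x hx))
  set trunc : ℝ → E3 → ℝ := fun ε x => ε * h (ε⁻¹ * v x) with htr
  have htr1 : ∀ ε, ContDiffOn ℝ 1 (trunc ε) Ω := fun ε =>
    contDiffOn_const.mul (hcd.comp_contDiffOn (contDiffOn_const.mul hv1))
  have htr0 : ∀ ε, 0 < ε → ∀ x ∉ Ω, trunc ε =ᶠ[𝓝 x] 0 := by
    intro ε hε x hx
    have : ∀ᶠ y in 𝓝 x, |v y| < ε := by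
      have := (hv.abs.tendsto x)
      rw [hv0 x hx, abs_zero] at this
      exact this.eventually_lt_const hε
    filter_upwards [this] with y hy
    have : |ε⁻¹ * v y| ≤ 1 := by
      rw [abs_mul, abs_of_pos (inv_pos.2 hε), inv_mul_le_iff₀ hε]
      linarith
    simp [htr, hz _ this]
  have hpdtr : ∀ ε, 0 < ε → ∀ i, ∀ x ∈ Ω,
      pd i (trunc ε) x = deriv h (ε⁻¹ * v x) * pd i v x := by
    intro ε hε i x hx
    have hh : HasDerivAt h (deriv h (ε⁻¹ * v x)) (ε⁻¹ * v x) :=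
      (hcd.differentiable (by norm_num) _).hasDerivAt
    have h1 := ((hh.comp_hasFDerivAt x ((hdv x hx).hasFDerivAt.const_mul ε⁻¹)).const_mul ε).fderiv
    have h2 : fderiv ℝ (trunc ε) x = _ := h1
    simp only [pd, h2, _root_.smul_apply, smul_eq_mul]
    field_simp
  have hzero : ∀ ε, 0 < ε → ∫ x in Ω, (deriv h (ε⁻¹ * v x) * ∑ i, pd i v x * pd i u x
      + trunc ε x * lap u x) = 0 := by
    intro ε hε
    have hW : ∀ i, ContDiff ℝ 1 fun x => trunc ε x * pd i u x := by
      intro i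
      rw [contDiff_iff_contDiffAt]
      intro x
      by_cases hx : x ∈ Ω
      · exact ((htr1 ε).mul (contDiffOn_pd hΩ hu i)).contDiffAt (hΩ.mem_nhds hx)
      · refine (contDiffAt_const (c := (0 : ℝ))).congr_of_eventuallyEq ?_
        filter_upwards [htr0 ε hε x hx] with y hy
        simp [hy]
    have hWz : ∀ i, ∀ x ∉ Ω, (fun x => trunc ε x * pd i u x) =ᶠ[𝓝 x] fun _ => 0 := by
      intro i x hx
      filter_upwards [htr0 ε hε x hx] with y hy
      simp [hy]
    have hWcs : ∀ i, HasCompactSupport fun x => trunc ε x * pd i u x := fun i =>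
      HasCompactSupport.intro hb.isCompact_closure fun x hx =>
        (hWz i x fun hx' => hx (subset_closure hx')).self_of_nhds
    have hWint : ∀ i, ∫ x in Ω, pd i (fun x => trunc ε x * pd i u x) x = 0 := by
      intro i
      rw [setIntegral_eq_integral_of_forall_compl_eq_zero, integral_pd_eq_zero (hW i) (hWcs i)]
      intro x hx
      rw [pd_congr (hWz i x hx)]
      simp [pd]
    have hWi : ∀ i, Integrable (pd i (fun x => trunc ε x * pd i u x)) (volume.restrict Ω) := by
      intro i
      have hcont : Continuous (pd i (fun x => trunc ε x * pd i u x)) := by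
        simpa [continuousOn_univ] using continuousOn_pd isOpen_univ (hW i).contDiffOn i
      exact (hcont.integrable_of_hasCompactSupport
        ((hWcs i).fderiv_apply ℝ (EuclideanSpace.single i (1 : ℝ)))).integrableOn
    have hsum : ∫ x in Ω, ∑ i, pd i (fun x => trunc ε x * pd i u x) x = 0 := by
      rw [integral_finsetSum _ fun i _ => hWi i]
      exact Finset.sum_eq_zero fun i _ => hWint i
    rw [← hsum]
    refine setIntegral_congr_fun hΩ.measurableSet fun x hx => ?_
    have hdt : DifferentiableAt ℝ (trunc ε) x :=
      ((htr1 ε).differentiableOn (by norm_num)).differentiableAt (hΩ.mem_nhds hx)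
    simp only [lap_eq_sum_pd, Finset.mul_sum]
    rw [← Finset.sum_add_distrib]
    refine Finset.sum_congr rfl fun i _ => ?_
    rw [pd_mul hdt (hdpu i x hx), hpdtr ε hε i x hx]
    ring
  set εs : ℕ → ℝ := fun n => 1 / ((n : ℝ) + 1) with hεs
  have hεpos : ∀ n, 0 < εs n := fun n => by positivity
  have hε0 : Tendsto εs atTop (𝓝 0) := tendsto_one_div_add_atTop_nhds_zero_nat
  have hpt : ∀ x, v x ≠ 0 → ∀ᶠ n in atTop, trunc (εs n) x = v x ∧ deriv h ((εs n)⁻¹ * v x) = 1 := by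
    intro x hx
    have hpos : 0 < |v x| / 2 := by positivity
    filter_upwards [hε0.eventually_lt_const hpos] with n hn
    have h2 : 2 ≤ |(εs n)⁻¹ * v x| := by
      rw [abs_mul, abs_of_pos (inv_pos.2 (hεpos n)), le_inv_mul_iff₀ (hεpos n)]
      linarith
    refine ⟨?_, (hid _ h2).2⟩
    simp only [htr, (hid _ h2).1]
    rw [← mul_assoc, mul_inv_cancel₀ (hεpos n).ne', one_mul]
  have htr_le : ∀ ε, 0 < ε → ∀ x, |trunc ε x| ≤ |v x| := by
    intro ε hε x
    simp only [htr, abs_mul, abs_of_pos hε]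
    have := hle (ε⁻¹ * v x)
    rw [abs_mul, abs_of_pos (inv_pos.2 hε)] at this
    calc ε * |h (ε⁻¹ * v x)| ≤ ε * (ε⁻¹ * |v x|) := by gcongr
      _ = |v x| := by rw [← mul_assoc, mul_inv_cancel₀ hε.ne', one_mul]
  have hlim : Tendsto (fun n => ∫ x in Ω, (deriv h ((εs n)⁻¹ * v x) * ∑ i, pd i v x * pd i u x
      + trunc (εs n) x * lap u x)) atTop
      (𝓝 (∫ x in Ω, (∑ i, pd i v x * pd i u x + v x * lap u x))) := by
    refine tendsto_integral_of_dominated_convergence (fun _ => C * (3 * (L' * L)) + V * M) ?_ ?_ ?_ ?_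
    · intro n
      refine ContinuousOn.aestronglyMeasurable ?_ hΩ.measurableSet
      refine ContinuousOn.add (ContinuousOn.mul ?_ hgc)
        ((htr1 _).continuousOn.mul (continuousOn_lap hΩ hu))
      exact ((hcd.continuous_deriv (by norm_num)).comp (continuous_const.mul hv)).continuousOn
    · have hfin : IsFiniteMeasure (volume.restrict Ω) := ⟨by simpa using hb.measure_lt_top⟩
      exact integrable_const _
    · intro n
      refine (ae_restrict_iff' hΩ.measurableSet).2 (Eventually.of_forall fun x hx => ?_)
      rw [Real.norm_eq_abs]
      refine (abs_add_le _ _).trans (add_le_add ?_ ?_)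
      · rw [abs_mul]
        exact mul_le_mul (hC _) (hgrad x hx) (abs_nonneg _) hC0
      · rw [abs_mul]
        exact mul_le_mul ((htr_le _ (hεpos n) x).trans (hV' x hx)) (hM x hx) (abs_nonneg _)
          ((abs_nonneg _).trans (hV' x hx))
    · filter_upwards [ae_pd_eq_zero_of_eq_zero hΩ hv (hv1.differentiableOn (by norm_num))] with x hx
      by_cases hvx : v x = 0
      · have h0 : ∀ n, trunc (εs n) x = 0 := fun n => by
          simp [htr, hvx, hz 0]
        simp [hx hvx, h0, hvx]
      · refine tendsto_const_nhds.congr' ?_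
        filter_upwards [hpt x hvx] with n hn
        rw [hn.1, hn.2, one_mul]
  have h0 : ∫ x in Ω, (∑ i, pd i v x * pd i u x + v x * lap u x) = 0 :=
    tendsto_nhds_unique hlim (by simp [hzero _ (hεpos _)])
  rw [integral_add (integrableOn_of_bound hΩ hb hgc hgrad)
    (integrableOn_of_bound hΩ hb hlc hlb)] at h0
  linarith

/-- Functions vanishing outside `Ω`, of class `C²` in `Ω`, with bounded gradient and Laplacian. -/
structure DirichletFun (Ω : Set E3) (u : E3 → ℝ) : Prop where
  cont : Continuous u
  zero : ∀ x ∉ Ω, u x = 0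
  c2 : ContDiffOn ℝ 2 u Ω
  grad_bdd : ∃ L, ∀ x ∈ Ω, ‖fderiv ℝ u x‖ ≤ L
  lap_bdd : ∃ M, ∀ x ∈ Ω, |lap u x| ≤ M

/-- The squared norm of the gradient. -/
def gradSq (u : E3 → ℝ) (x : E3) : ℝ := ∑ i, pd i u x ^ 2

lemma gradSq_nonneg (u : E3 → ℝ) (x : E3) : 0 ≤ gradSq u x :=
  Finset.sum_nonneg fun _ _ => sq_nonneg _

lemma fderiv_apply_eq_sum (f : E3 → ℝ) (x y : E3) : fderiv ℝ f x y = ∑ i, pd i f x * y i := by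
  have hy : y = ∑ i, y i • (EuclideanSpace.single i (1 : ℝ) : E3) := by
    ext j
    simp [Fin.sum_univ_three]
    fin_cases j <;> simp
  conv_lhs => rw [hy]
  simp [pd, mul_comm]

lemma exists_abs_le {Ω : Set E3} (hb : Bornology.IsBounded Ω) {u : E3 → ℝ} (hu : Continuous u) :
    ∃ V, ∀ x ∈ Ω, |u x| ≤ V := by
  obtain ⟨V, hV⟩ := (hb.isCompact_closure).exists_bound_of_continuousOn hu.continuousOn
  exact ⟨V, fun x hx => hV x (subset_closure hx)⟩

lemma integral_fderiv_self {G : E3 → ℝ} {Ω : Set E3} (hΩ : IsOpen Ω)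
    (hb : Bornology.IsBounded Ω) (hG : Continuous G) (hG0 : ∀ x ∉ Ω, G x = 0)
    (hG1 : ContDiffOn ℝ 1 G Ω) {L : ℝ} (hL : ∀ x ∈ Ω, ‖fderiv ℝ G x‖ ≤ L) :
    ∫ x in Ω, fderiv ℝ G x x = -3 * ∫ x in Ω, G x := by
  have hcd := contDiff_norm_sub_sq (0 : E3)
  obtain ⟨L₂, hL₂⟩ := (hb.isCompact_closure).exists_bound_of_continuousOn
    (hcd.continuous_fderiv (by norm_num)).continuousOn
  have h := green hΩ hb hcd.contDiffOn (fun x hx => hL₂ x (subset_closure hx))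
    (M := 6) (fun x _ => by rw [lap_norm_sub_sq]; norm_num) hG hG0 hG1 hL
  simp only [pd_norm_sub_sq, lap_norm_sub_sq] at h
  have e : ∀ x : E3, ∑ i, pd i G x * (2 * (x i - (0 : E3) i)) = 2 * fderiv ℝ G x x := by
    intro x
    rw [fderiv_apply_eq_sum, Finset.mul_sum]
    refine Finset.sum_congr rfl fun i _ => ?_
    simp
    ring
  simp only [e, integral_const_mul, integral_mul_const] at h
  linarith

lemma abs_sum_pd_mul_le {f g : E3 → ℝ} {A B : ℝ} {x : E3} (hA : ‖fderiv ℝ f x‖ ≤ A)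
    (hB : ‖fderiv ℝ g x‖ ≤ B) : |∑ i, pd i f x * pd i g x| ≤ 3 * (A * B) := by
  refine (Finset.abs_sum_le_sum_abs _ _).trans ?_
  refine (Finset.sum_le_card_nsmul _ _ (A * B) fun i _ => ?_).trans (by simp)
  rw [abs_mul]
  exact mul_le_mul ((abs_pd_le f x i).trans hA) ((abs_pd_le g x i).trans hB)
    (abs_nonneg _) ((norm_nonneg _).trans hA)

lemma integrableOn_gradSq {u : E3 → ℝ} {Ω : Set E3} (hΩ : IsOpen Ω) (hb : Bornology.IsBounded Ω)
    (hu : ContDiffOn ℝ 1 u Ω) {L : ℝ} (hL : ∀ x ∈ Ω, ‖fderiv ℝ u x‖ ≤ L) :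
    IntegrableOn (gradSq u) Ω := by
  refine integrableOn_of_bound hΩ hb
    (continuousOn_finsetSum _ fun i _ => (continuousOn_pd hΩ hu i).pow 2)
    (C := 3 * (L * L)) fun x hx => ?_
  simpa only [gradSq, ← sq] using abs_sum_pd_mul_le (hL x hx) (hL x hx)

lemma hasDerivAt_ray {Ω : Set E3} (hΩ : IsOpen Ω) {u : E3 → ℝ} (hu : ContDiffOn ℝ 1 u Ω) (x : E3) {t : ℝ} (ht : t • x ∈ Ω) :
    HasDerivAt (fun t : ℝ => u (t • x)) (fderiv ℝ u (t • x) x) t := by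
  have hd := ((hu.differentiableOn (by norm_num)).differentiableAt (hΩ.mem_nhds ht)).hasFDerivAt
  have hl : HasDerivAt (fun t : ℝ => t • x) x t := by
    simpa using (hasDerivAt_id t).smul_const x
  exact hd.comp_hasDerivAt t hl

lemma abs_ray_sub_le {Ω : Set E3} (hΩ : IsOpen Ω)
    (hstar : ∀ s : ℝ, 1 ≤ s → ∀ x : E3, s • x ∈ Ω → x ∈ Ω) {u : E3 → ℝ} (hc : Continuous u) (h0 : ∀ x ∉ Ω, u x = 0)
    (hu : ContDiffOn ℝ 1 u Ω) {L : ℝ} (hL0 : 0 ≤ L) (hL : ∀ x ∈ Ω, ‖fderiv ℝ u x‖ ≤ L)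
    (x : E3) {s : ℝ} (hs : 1 ≤ s) : |u (s • x) - u x| ≤ L * ‖x‖ * (s - 1) := by
  classical
  have hcont : Continuous fun t : ℝ => u (t • x) := hc.comp (by fun_prop)
  have h := norm_image_sub_le_of_norm_deriv_right_le_segment (a := 1) (b := s)
    (f := fun t : ℝ => u (t • x)) (f' := fun t => if t • x ∈ Ω then fderiv ℝ u (t • x) x else 0)
    (C := L * ‖x‖) hcont.continuousOn (fun t ht => ?_) (fun t ht => ?_) s ⟨hs, le_rfl⟩
  · simpa using h
  · by_cases hx : t • x ∈ Ω
    · simpa [hx] using (hasDerivAt_ray hΩ hu x hx).hasDerivWithinAt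
    · simp only [hx, if_false]
      have hz : ∀ t' ∈ Ici t, u (t' • x) = 0 := by
        intro t' ht'
        refine h0 _ fun hmem => hx (hstar (t' / t) ?_ _ ?_)
        · rw [le_div_iff₀ (by linarith [ht.1])]
          simpa using ht'
        · rwa [smul_smul, div_mul_cancel₀]
          linarith [ht.1]
      exact (hasDerivWithinAt_const t (Ici t) (0 : ℝ)).congr hz (hz t self_mem_Ici)
  · by_cases hx : t • x ∈ Ω
    · simp only [hx, if_true]
      exact ((fderiv ℝ u (t • x)).le_opNorm x).trans (by gcongr; exact hL _ hx)
    · simp only [hx, if_false, norm_zero]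
      positivity

lemma tendsto_ray_quotient {Ω : Set E3} (hΩ : IsOpen Ω) (hb : Bornology.IsBounded Ω)
    (hstar : ∀ s : ℝ, 1 ≤ s → ∀ x : E3, s • x ∈ Ω → x ∈ Ω) {u k : E3 → ℝ} (hc : Continuous u) (h0 : ∀ x ∉ Ω, u x = 0)
    (hu : ContDiffOn ℝ 1 u Ω) {L : ℝ} (hL : ∀ x ∈ Ω, ‖fderiv ℝ u x‖ ≤ L)
    (hk : ContinuousOn k Ω) {K : ℝ} (hK : ∀ x ∈ Ω, |k x| ≤ K) :
    Tendsto (fun s : ℝ => (∫ x in Ω, k x * (u (s • x) - u x)) / (s - 1)) (𝓝[>] 1)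
      (𝓝 (∫ x in Ω, k x * fderiv ℝ u x x)) := by
  obtain ⟨R, hR⟩ := hb.subset_closedBall 0
  have hR' : ∀ x ∈ Ω, ‖x‖ ≤ R := fun x hx => by simpa using hR hx
  have hL' : ∀ x ∈ Ω, ‖fderiv ℝ u x‖ ≤ |L| := fun x hx => (hL x hx).trans (le_abs_self L)
  have e : (fun s : ℝ => (∫ x in Ω, k x * (u (s • x) - u x)) / (s - 1))
      = fun s : ℝ => ∫ x in Ω, k x * ((u (s • x) - u x) / (s - 1)) := by
    ext s
    rw [← integral_div]
    simp only [mul_div_assoc]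
  rw [e]
  refine tendsto_integral_filter_of_dominated_convergence (fun _ => K * (|L| * R)) ?_ ?_ ?_ ?_
  · refine Eventually.of_forall fun s => ContinuousOn.aestronglyMeasurable ?_ hΩ.measurableSet
    have : Continuous fun x : E3 => (u (s • x) - u x) / (s - 1) :=
      ((hc.comp (by fun_prop)).sub hc).div_const _
    exact hk.mul this.continuousOn
  · filter_upwards [self_mem_nhdsWithin] with s hs
    refine (ae_restrict_iff' hΩ.measurableSet).2 (Eventually.of_forall fun x hx => ?_)
    have hs' : 0 < s - 1 := sub_pos.2 hs
    have h1 := abs_ray_sub_le hΩ hstar hc h0 hu (abs_nonneg L) hL' x (le_of_lt hs)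
    rw [Real.norm_eq_abs, abs_mul, abs_div, abs_of_pos hs']
    refine mul_le_mul (hK x hx) ?_ (by positivity) ((abs_nonneg _).trans (hK x hx))
    rw [div_le_iff₀ hs']
    refine h1.trans ?_
    gcongr
    exact hR' x hx
  · have hfin : IsFiniteMeasure (volume.restrict Ω) := ⟨by simpa using hb.measure_lt_top⟩
    exact integrable_const _
  · refine (ae_restrict_iff' hΩ.measurableSet).2 (Eventually.of_forall fun x hx => ?_)
    have hd := hasDerivAt_ray hΩ hu x (t := 1) (by simpa using hx)
    rw [one_smul] at hd
    have hsl := (hasDerivAt_iff_tendsto_slope.1 hd).mono_left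
      (nhdsWithin_mono 1 fun s (hs : 1 < s) => hs.ne')
    refine Tendsto.const_mul _ (hsl.congr fun s => ?_)
    rw [slope_def_field, one_smul]

lemma pd_dilation (u : E3 → ℝ) (s : ℝ) (i : Fin 3) (x : E3) :
    pd i (fun y => u (s • y)) x = s * pd i u (s • x) := by
  simp [pd, fderiv_comp_smul]

open scoped Pointwise in
/-- The Dirichlet energy near the boundary is controlled by the energy defect between a function
and its dilation. -/
lemma setIntegral_gradSq_sdiff_le {Ω : Set E3} (hΩ : IsOpen Ω) (hb : Bornology.IsBounded Ω)
    (hstar : ∀ s : ℝ, 1 ≤ s → ∀ x : E3, s • x ∈ Ω → x ∈ Ω) {u : E3 → ℝ} (hu : DirichletFun Ω u) {s : ℝ} (hs : 1 ≤ s) :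
    ∫ x in Ω \ {x | s • x ∈ Ω}, gradSq u x ≤
      (∫ x in Ω, gradSq u x) + s⁻¹ * (∫ x in Ω, gradSq u x)
        + 2 * ∫ x in Ω, lap u x * u (s • x) := by
  obtain ⟨L, hL⟩ := hu.grad_bdd
  obtain ⟨M, hM⟩ := hu.lap_bdd
  have hs0 : 0 < s := by linarith
  set S : Set E3 := {x | s • x ∈ Ω} with hS
  have hScont : Continuous fun x : E3 => s • x := by fun_prop
  have hSo : IsOpen S := hΩ.preimage hScont
  have hSΩ : S ⊆ Ω := fun x hx => hstar s hs x hx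
  have hSb : Bornology.IsBounded S := hb.subset hSΩ
  have hu1 : ContDiffOn ℝ 1 u Ω := hu.c2.of_le (by norm_num)
  set v : E3 → ℝ := fun x => u (s • x) with hv
  have hvc : Continuous v := hu.cont.comp hScont
  have hv1 : ContDiffOn ℝ 1 v S := hu1.comp (contDiff_id.const_smul s).contDiffOn fun x hx => hx
  have hvL : ∀ x ∈ S, ‖fderiv ℝ v x‖ ≤ s * L := fun x hx => by
    rw [hv, fderiv_comp_smul, norm_smul, Real.norm_of_nonneg hs0.le]
    gcongr
    exact hL _ hx
  have hg := green hSo hSb (hu.c2.mono hSΩ) (fun x hx => hL x (hSΩ hx)) (fun x hx => hM x (hSΩ hx))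
    hvc (fun x hx => hu.zero _ hx) hv1 hvL
  have hext : ∫ x in S, v x * lap u x = ∫ x in Ω, lap u x * v x := by
    have hz : ∀ x ∈ Ω \ S, v x * lap u x = 0 := fun x hx => by
      have h0 : v x = 0 := hu.zero _ hx.2
      rw [h0, zero_mul]
    have h := setIntegral_eq_of_subset_of_forall_sdiff_eq_zero (μ := volume)
      hΩ.measurableSet hSΩ hz
    rw [← h]
    exact integral_congr_ae (Eventually.of_forall fun x => mul_comm _ _)
  have pdc : ∀ i, ContinuousOn (pd i u) Ω := fun i => continuousOn_pd hΩ hu1 i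
  have pvc : ∀ i, ContinuousOn (pd i v) S := fun i => continuousOn_pd hSo hv1 i
  have iu := integrableOn_gradSq hΩ hb hu1 hL
  have iv := integrableOn_gradSq hSo hSb hv1 hvL
  have iuv : IntegrableOn (fun x => ∑ i, pd i v x * pd i u x) S :=
    integrableOn_of_bound hSo hSb
      (continuousOn_finsetSum _ fun i _ => (pvc i).mul ((pdc i).mono hSΩ))
      fun x hx => abs_sum_pd_mul_le (hvL x hx) (hL x (hSΩ hx))
  have hev : ∫ x in S, gradSq v x = s⁻¹ * ∫ x in Ω, gradSq u x := by
    have e1 : ∀ x, gradSq v x = s ^ 2 * gradSq u (s • x) := fun x => by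
      simp only [gradSq, hv, pd_dilation, mul_pow, Finset.mul_sum]
    have e2 : s • S = Ω := by
      ext x
      rw [mem_smul_set_iff_inv_smul_mem₀ hs0.ne']
      simp [hS, smul_smul, mul_inv_cancel₀ hs0.ne']
    simp only [e1]
    rw [integral_const_mul, Measure.setIntegral_comp_smul_of_pos _ _ _ hs0, e2]
    simp only [finrank_euclideanSpace, Fintype.card_fin, smul_eq_mul]
    field_simp
  have hsq : 0 ≤ ∫ x in S, ((gradSq u x - 2 * ∑ i, pd i v x * pd i u x) + gradSq v x) := by
    refine integral_nonneg fun x => ?_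
    have e : (gradSq u x - 2 * ∑ i, pd i v x * pd i u x) + gradSq v x
        = ∑ i, (pd i u x - pd i v x) ^ 2 := by
      simp only [gradSq, Finset.mul_sum, ← Finset.sum_sub_distrib, ← Finset.sum_add_distrib]
      exact Finset.sum_congr rfl fun i _ => by ring
    simp only [e]
    exact Finset.sum_nonneg fun _ _ => sq_nonneg _
  have i1 : IntegrableOn (fun x => gradSq u x - 2 * ∑ i, pd i v x * pd i u x) S :=
    (iu.mono_set hSΩ).sub (iuv.const_mul 2)
  rw [integral_add i1 iv, integral_sub (iu.mono_set hSΩ) (iuv.const_mul 2), integral_const_mul, hev, hg, hext] at hsq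
  have hsplit := integral_inter_add_sdiff (s := Ω) (f := gradSq u) hSo.measurableSet iu
  rw [inter_eq_self_of_subset_right hSΩ] at hsplit
  linarith

lemma tendsto_energy_defect {Ω : Set E3} (hΩ : IsOpen Ω) (hb : Bornology.IsBounded Ω)
    (hstar : ∀ s : ℝ, 1 ≤ s → ∀ x : E3, s • x ∈ Ω → x ∈ Ω) {u : E3 → ℝ} (hu : DirichletFun Ω u) :
    Tendsto (fun s : ℝ => ((∫ x in Ω, gradSq u x) + s⁻¹ * (∫ x in Ω, gradSq u x)
        + 2 * ∫ x in Ω, lap u x * u (s • x)) / (s - 1)) (𝓝[>] 1)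
      (𝓝 ((∫ x in Ω, lap u x * u x) + 2 * ∫ x in Ω, lap u x * fderiv ℝ u x x)) := by
  obtain ⟨L, hL⟩ := hu.grad_bdd
  obtain ⟨M, hM⟩ := hu.lap_bdd
  have hu1 : ContDiffOn ℝ 1 u Ω := hu.c2.of_le (by norm_num)
  have hlc := continuousOn_lap hΩ hu.c2
  have hA : ∫ x in Ω, gradSq u x = -∫ x in Ω, lap u x * u x := by
    have := green hΩ hb hu.c2 hL hM hu.cont hu.zero hu1 hL
    simp only [gradSq, sq, this, mul_comm]
  set A := ∫ x in Ω, gradSq u x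
  have hq := (tendsto_ray_quotient hΩ hb hstar hu.cont hu.zero hu1 hL hlc hM).const_mul 2
  have hinv : Tendsto (fun s : ℝ => -A * s⁻¹) (𝓝[>] 1) (𝓝 (∫ x in Ω, lap u x * u x)) := by
    have : ContinuousAt (fun s : ℝ => -A * s⁻¹) 1 :=
      continuousAt_const.mul (continuousAt_inv₀ one_ne_zero)
    have h := this.tendsto.mono_left (nhdsWithin_le_nhds (s := Ioi 1))
    have e : -A * (1 : ℝ)⁻¹ = ∫ x in Ω, lap u x * u x := by
      rw [inv_one, mul_one, hA, neg_neg]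
    rwa [e] at h
  refine (hinv.add hq).congr' ?_
  filter_upwards [self_mem_nhdsWithin] with s hs
  have hs1 : 1 < s := hs
  have hs' : s - 1 ≠ 0 := (sub_pos.2 hs1).ne'
  have hs0 : s ≠ 0 := by linarith
  have int : ∀ t : ℝ, IntegrableOn (fun x => lap u x * u (t • x)) Ω := by
    intro t
    have hc : Continuous fun x : E3 => u (t • x) := hu.cont.comp (by fun_prop)
    obtain ⟨V, hV⟩ := exists_abs_le hb hc
    refine integrableOn_of_bound hΩ hb (hlc.mul hc.continuousOn) (C := M * V) fun x hx => ?_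
    rw [abs_mul]
    exact mul_le_mul (hM x hx) (hV x hx) (abs_nonneg _) ((abs_nonneg _).trans (hM x hx))
  have hsub : ∫ x in Ω, lap u x * (u (s • x) - u x)
      = (∫ x in Ω, lap u x * u (s • x)) - ∫ x in Ω, lap u x * u x := by
    simp only [mul_sub]
    have i1 : IntegrableOn (fun x => lap u x * u x) Ω := by simpa using int 1
    exact integral_sub (int s) i1
  rw [hsub]
  have hA' : ∫ x in Ω, lap u x * u x = -A := by rw [hA, neg_neg]
  rw [hA']
  field_simp
  ring

lemma exists_tendsto_fderiv {f : E3 → ℝ} {Ω : Set E3} (hΩ : IsOpen Ω)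
    (hf : ContDiffOn ℝ 1 f (closure Ω)) {x : E3} (hx : x ∈ closure Ω) :
    ∃ ℓ, Tendsto (fderiv ℝ f) (𝓝[Ω] x) (𝓝 ℓ) := by
  have h : ContDiffWithinAt ℝ (0 + 1) f (closure Ω) x := by simpa using hf x hx
  obtain ⟨v, hv, -, f', hf', hc⟩ := (contDiffWithinAt_succ_iff_hasFDerivWithinAt (by simp)).1 h
  rw [insert_eq_of_mem hx] at hv
  have hvΩ : v ∈ 𝓝[Ω] x := nhdsWithin_mono x subset_closure hv
  refine ⟨f' x, (hc.continuousWithinAt.tendsto.mono_left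
    (nhdsWithin_le_of_mem hvΩ)).congr' ?_⟩
  filter_upwards [eventually_eventually_nhdsWithin.2 hvΩ, self_mem_nhdsWithin] with y hy hyΩ
  rw [hΩ.nhdsWithin_eq hyΩ] at hy
  have hy' : v ∈ 𝓝 y := hy
  exact ((hf' y (mem_of_mem_nhds hy')).hasFDerivAt hy').fderiv.symm

lemma exists_norm_fderiv_le {f : E3 → ℝ} {Ω : Set E3} (hΩ : IsOpen Ω)
    (hb : Bornology.IsBounded Ω) (hf : ContDiffOn ℝ 1 f (closure Ω)) :
    ∃ L, ∀ x ∈ Ω, ‖fderiv ℝ f x‖ ≤ L := by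
  have hc : ContinuousOn (extendFrom Ω (fderiv ℝ f)) (closure Ω) :=
    continuousOn_extendFrom subset_rfl fun x hx => exists_tendsto_fderiv hΩ hf hx
  obtain ⟨L, hL⟩ := hb.isCompact_closure.exists_bound_of_continuousOn hc
  refine ⟨L, fun x hx => ?_⟩
  have h := hL x (subset_closure hx)
  rwa [extendFrom_eq (subset_closure hx)
    (continuousOn_fderiv hΩ (hf.mono subset_closure) x hx)] at h

lemma indicator_eventuallyEq_self {f : E3 → ℝ} {Ω : Set E3} (hΩ : IsOpen Ω) {x : E3}
    (hx : x ∈ Ω) : Ω.indicator f =ᶠ[𝓝 x] f :=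
  eventuallyEq_of_mem (hΩ.mem_nhds hx) fun _ hy => indicator_of_mem hy f

lemma dirichletFun_indicator {f : E3 → ℝ} {Ω : Set E3} (hΩ : IsOpen Ω)
    (hb : Bornology.IsBounded Ω) (h2 : ContDiffOn ℝ 2 f Ω) (h1 : ContDiffOn ℝ 1 f (closure Ω))
    (h0 : ∀ x ∈ frontier Ω, f x = 0) (hlap : ∃ M, ∀ x ∈ Ω, |lap f x| ≤ M) :
    DirichletFun Ω (Ω.indicator f) where
  cont := continuous_indicator h0 h1.continuousOn
  zero _ hx := indicator_of_notMem hx f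
  c2 := h2.congr fun _ hx => indicator_of_mem hx f
  grad_bdd := by
    obtain ⟨L, hL⟩ := exists_norm_fderiv_le hΩ hb h1
    exact ⟨L, fun x hx => by
      rw [(indicator_eventuallyEq_self hΩ hx).fderiv_eq]; exact hL x hx⟩
  lap_bdd := by
    obtain ⟨M, hM⟩ := hlap
    exact ⟨M, fun x hx => by
      rw [lap_congr (indicator_eventuallyEq_self hΩ hx)]; exact hM x hx⟩

lemma hasDerivAt_abs_pow_five (t : ℝ) :
    HasDerivAt (fun t : ℝ => |t| ^ 5) (5 * (|t| ^ 3 * t)) t := by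
  have h := hasDerivAt_abs_rpow t (p := 5) (by norm_num)
  have e : (fun t : ℝ => |t| ^ (5 : ℝ)) = fun t : ℝ => |t| ^ 5 := by
    ext t
    exact_mod_cast Real.rpow_natCast |t| 5
  have e3 : |t| ^ ((5 : ℝ) - 2) = |t| ^ 3 := by
    rw [show (5 : ℝ) - 2 = ((3 : ℕ) : ℝ) by norm_num, Real.rpow_natCast]
  rwa [e, e3, mul_assoc] at h

lemma contDiff_abs_pow_five : ContDiff ℝ 1 fun t : ℝ => |t| ^ 5 := by
  rw [contDiff_one_iff_deriv]
  refine ⟨fun t => (hasDerivAt_abs_pow_five t).differentiableAt, ?_⟩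
  rw [funext fun t => (hasDerivAt_abs_pow_five t).deriv]
  fun_prop

/-- The Pohozaev identity for the potential of the system. -/
lemma integral_potential {Ω : Set E3} (hΩ : IsOpen Ω) (hb : Bornology.IsBounded Ω) {q lam : ℝ}
    {u φ : E3 → ℝ} (hu : DirichletFun Ω u) (hφ : DirichletFun Ω φ) :
    ∫ x in Ω, ((lam * u x + q * |u x| ^ 3 * u x * φ x) * fderiv ℝ u x x
        + q / 5 * |u x| ^ 5 * fderiv ℝ φ x x)
      = -3 * ∫ x in Ω, (lam / 2 * u x ^ 2 + q / 5 * (|u x| ^ 5 * φ x)) := by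
  obtain ⟨L, hL⟩ := hu.grad_bdd
  obtain ⟨L', hL'⟩ := hφ.grad_bdd
  obtain ⟨V, hV⟩ := exists_abs_le hb hu.cont
  obtain ⟨W, hW⟩ := exists_abs_le hb hφ.cont
  have hu1 : ContDiffOn ℝ 1 u Ω := hu.c2.of_le (by norm_num)
  have hφ1 : ContDiffOn ℝ 1 φ Ω := hφ.c2.of_le (by norm_num)
  set G : E3 → ℝ := fun x => lam / 2 * u x ^ 2 + q / 5 * (|u x| ^ 5 * φ x) with hG
  have hd : ∀ x ∈ Ω, HasFDerivAt G ((lam * u x + q * |u x| ^ 3 * u x * φ x) • fderiv ℝ u x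
      + (q / 5 * |u x| ^ 5) • fderiv ℝ φ x) x := by
    intro x hx
    have du := ((hu1.differentiableOn (by norm_num)).differentiableAt
      (hΩ.mem_nhds hx)).hasFDerivAt
    have dφ := ((hφ1.differentiableOn (by norm_num)).differentiableAt
      (hΩ.mem_nhds hx)).hasFDerivAt
    have d5 := (hasDerivAt_abs_pow_five (u x)).comp_hasFDerivAt x du
    have h := ((du.pow 2).const_mul (lam / 2)).add ((d5.mul dφ).const_mul (q / 5))
    refine h.congr_fderiv ?_
    ext y
    simp
    ring
  have hGc : Continuous G := by
    have := hu.cont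
    have := hφ.cont
    fun_prop
  have hG1 : ContDiffOn ℝ 1 G Ω :=
    (contDiffOn_const.mul (hu1.pow 2)).add
      (contDiffOn_const.mul ((contDiff_abs_pow_five.comp_contDiffOn hu1).mul hφ1))
  have hGL : ∀ x ∈ Ω, ‖fderiv ℝ G x‖ ≤
      (|lam| * V + |q| * V ^ 3 * V * W) * L + |q / 5| * V ^ 5 * L' := by
    intro x hx
    have hux := hV x hx
    have hφx := hW x hx
    have hV0 : 0 ≤ V := (abs_nonneg _).trans hux
    have hW0 : 0 ≤ W := (abs_nonneg _).trans hφx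
    rw [(hd x hx).fderiv]
    refine (norm_add_le _ _).trans (add_le_add ?_ ?_)
    · rw [norm_smul]
      refine mul_le_mul ?_ (hL x hx) (norm_nonneg _) (by positivity)
      refine (norm_add_le _ _).trans ?_
      simp only [norm_mul, norm_pow, Real.norm_eq_abs, abs_abs]
      gcongr
    · rw [norm_smul]
      refine mul_le_mul ?_ (hL' x hx) (norm_nonneg _) (by positivity)
      simp only [norm_mul, norm_pow, Real.norm_eq_abs, abs_abs]
      gcongr
  have h := integral_fderiv_self hΩ hb hGc (fun x hx => by simp [hG, hu.zero x hx]) hG1 hGL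
  rw [← h]
  refine setIntegral_congr_fun hΩ.measurableSet fun x hx => ?_
  simp [(hd x hx).fderiv]

/-- The Dirichlet energy of `φ` in the boundary layer removed by a dilation is negligible with
respect to the thickness of the layer. -/
lemma eventually_setIntegral_gradSq_le {Ω : Set E3} (hΩ : IsOpen Ω) (hb : Bornology.IsBounded Ω)
    (hstar : ∀ s : ℝ, 1 ≤ s → ∀ x : E3, s • x ∈ Ω → x ∈ Ω) {q lam : ℝ} (hlam : lam ≤ 0)
    {u φ : E3 → ℝ} (hu : DirichletFun Ω u) (hφ : DirichletFun Ω φ)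
    (hueq : ∀ x ∈ Ω, -lap u x = lam * u x + q * |u x| ^ 3 * u x * φ x)
    (hφeq : ∀ x ∈ Ω, -lap φ x = q * |u x| ^ 5) {ε : ℝ} (hε : 0 < ε) :
    ∀ᶠ s in 𝓝[>] (1 : ℝ), ∫ x in Ω \ {x | s • x ∈ Ω}, gradSq φ x ≤ ε * (s - 1) := by
  obtain ⟨L, hL⟩ := hu.grad_bdd
  obtain ⟨L', hL'⟩ := hφ.grad_bdd
  have hu1 : ContDiffOn ℝ 1 u Ω := hu.c2.of_le (by norm_num)
  have hφ1 : ContDiffOn ℝ 1 φ Ω := hφ.c2.of_le (by norm_num)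
  have intc : ∀ {g : E3 → ℝ}, Continuous g → IntegrableOn g Ω := fun {g} hg => by
    obtain ⟨C, hC⟩ := exists_abs_le hb hg
    exact integrableOn_of_bound hΩ hb hg.continuousOn hC
  have intl : ∀ {f : E3 → ℝ}, DirichletFun Ω f →
      IntegrableOn (fun x => lap f x * fderiv ℝ f x x) Ω := by
    intro f hf
    obtain ⟨L, hL⟩ := hf.grad_bdd
    obtain ⟨M, hM⟩ := hf.lap_bdd
    obtain ⟨R, hR⟩ := exists_abs_le hb (continuous_norm (E := E3))
    refine integrableOn_of_bound hΩ hb ((continuousOn_lap hΩ hf.c2).mul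
      ((continuousOn_fderiv hΩ (hf.c2.of_le (by norm_num))).clm_apply continuousOn_id))
      (C := M * (L * R)) fun x hx => ?_
    have h1 := hL x hx
    have h2 := hM x hx
    have h3 := hR x hx
    rw [abs_norm] at h3
    rw [abs_mul]
    refine mul_le_mul h2 ?_ (abs_nonneg _) ((abs_nonneg _).trans h2)
    exact ((fderiv ℝ f x).le_opNorm x).trans
      (mul_le_mul h1 h3 (norm_nonneg _) ((norm_nonneg _).trans h1))
  have hcu := hu.cont
  have hcφ := hφ.cont
  have iU : IntegrableOn (fun x => u x ^ 2) Ω := intc (by fun_prop)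
  have iD : IntegrableOn (fun x => |u x| ^ 5 * φ x) Ω := intc (by fun_prop)
  set U := ∫ x in Ω, u x ^ 2 with hU
  set D := ∫ x in Ω, |u x| ^ 5 * φ x with hD
  have hU0 : 0 ≤ U := integral_nonneg fun x => sq_nonneg _
  have e1 : ∫ x in Ω, lap u x * u x = -lam * U - q * D := by
    rw [hU, hD, ← integral_const_mul, ← integral_const_mul,
      ← integral_sub (iU.const_mul _) (iD.const_mul _)]
    refine setIntegral_congr_fun hΩ.measurableSet fun x hx => ?_
    have h5 : |u x| ^ 5 = |u x| ^ 3 * u x ^ 2 := by rw [← sq_abs (u x)]; ring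
    have := hueq x hx
    simp only [h5]
    linear_combination (-u x) * this
  have e2 : ∫ x in Ω, lap φ x * φ x = -(q * D) := by
    rw [hD, ← integral_const_mul, ← integral_neg]
    refine setIntegral_congr_fun hΩ.measurableSet fun x hx => ?_
    have := hφeq x hx
    linear_combination (-φ x) * this
  have e3 : (∫ x in Ω, lap u x * fderiv ℝ u x x) + (∫ x in Ω, lap φ x * fderiv ℝ φ x x) / 5
      = 3 * (lam / 2 * U + q / 5 * D) := by
    have hp := integral_potential (q := q) (lam := lam) hΩ hb hu hφ
    rw [integral_add (iU.const_mul _) (iD.const_mul _), integral_const_mul,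
      integral_const_mul] at hp
    rw [div_eq_mul_inv, ← integral_mul_const,
      ← integral_add (intl hu) ((intl hφ).mul_const _)]
    have hneg : ∫ x in Ω, (lap u x * fderiv ℝ u x x + lap φ x * fderiv ℝ φ x x * 5⁻¹)
        = -∫ x in Ω, ((lam * u x + q * |u x| ^ 3 * u x * φ x) * fderiv ℝ u x x
        + q / 5 * |u x| ^ 5 * fderiv ℝ φ x x) := by
      rw [← integral_neg]
      refine setIntegral_congr_fun hΩ.measurableSet fun x hx => ?_
      linear_combination (-fderiv ℝ u x x) * hueq x hx - (fderiv ℝ φ x x / 5) * hφeq x hx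
    rw [hneg, hp]
    ring
  have hlim := (tendsto_energy_defect hΩ hb hstar hu).add
    ((tendsto_energy_defect hΩ hb hstar hφ).div_const 5)
  have hneg : ((∫ x in Ω, lap u x * u x) + 2 * ∫ x in Ω, lap u x * fderiv ℝ u x x)
      + ((∫ x in Ω, lap φ x * φ x) + 2 * ∫ x in Ω, lap φ x * fderiv ℝ φ x x) / 5 < ε / 5 := by
    have : lam * U ≤ 0 := mul_nonpos_of_nonpos_of_nonneg hlam hU0
    linarith
  filter_upwards [hlim.eventually_lt_const hneg, self_mem_nhdsWithin] with s hs hs1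
  have hs0 : 0 < s - 1 := sub_pos.2 hs1
  have h1 := setIntegral_gradSq_sdiff_le hΩ hb hstar hu (le_of_lt hs1)
  have h2 := setIntegral_gradSq_sdiff_le hΩ hb hstar hφ (le_of_lt hs1)
  have h3 : 0 ≤ ∫ x in Ω \ {x | s • x ∈ Ω}, gradSq u x :=
    integral_nonneg fun x => gradSq_nonneg u x
  have h4 := div_le_div_of_nonneg_right h2 hs0.le
  have h5 := div_nonneg (h3.trans h1) hs0.le
  rw [← div_le_iff₀ hs0]
  linarith

lemma eventually_eq_zero_of_lap_nonpos {φ : E3 → ℝ} {Ω : Set E3} (hΩ : IsOpen Ω)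
    (hc : Continuous φ) (h2 : ContDiffOn ℝ 2 φ Ω) (hlap : ∀ x ∈ Ω, lap φ x ≤ 0)
    (hnn : ∀ x, 0 ≤ φ x) {z : E3} (hz : z ∈ Ω) (hz0 : φ z = 0) : ∀ᶠ y in 𝓝 z, φ y = 0 := by
  obtain ⟨ρ, hρ, hρΩ⟩ := Metric.isOpen_iff.1 hΩ z hz
  filter_upwards [ball_mem_nhds z (half_pos hρ)] with p hp
  by_contra hp0
  have hZ : IsClosed (φ ⁻¹' {0}) := isClosed_singleton.preimage hc
  obtain ⟨y, hy, hyd⟩ := hZ.exists_infDist_eq_dist ⟨z, hz0⟩ p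
  have hy0 : φ y = 0 := hy
  set R := dist p y with hR
  have hR0 : 0 < R := dist_pos.2 fun h => hp0 (h ▸ hy0)
  have hRz : R ≤ dist p z := hyd ▸ infDist_le_dist_of_mem (show z ∈ φ ⁻¹' {0} from hz0)
  have hpz : dist p z < ρ / 2 := hp
  have hsub : closedBall p R ⊆ Ω := fun x hx => hρΩ <| by
    have h1 : dist x p ≤ R := hx
    have := dist_triangle x p z
    rw [mem_ball]
    linarith
  have hpos : ∀ x ∈ ball p R, 0 < φ x := fun x hx =>
    (hnn x).lt_of_ne' fun h0 => by
      have h1 := infDist_le_dist_of_mem (x := p) (show x ∈ φ ⁻¹' {0} from h0)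
      rw [hyd, dist_comm] at h1
      exact absurd h1 (not_le.2 hx)
  have hball := ball_subset_closedBall.trans hsub
  obtain ⟨c, hc0, hcb⟩ := hopf_ball hR0 hc (h2.mono hball) (fun x hx => hlap x (hball hx)) hpos hnn
  have hyR : y ∈ sphere p R := by rw [mem_sphere, hR, dist_comm]
  have hyΩ := hsub (sphere_subset_closedBall hyR)
  have hfd : HasFDerivAt φ (0 : E3 →L[ℝ] ℝ) y := by
    have hmin : IsLocalMin φ y := Eventually.of_forall fun x => by rw [hy0]; exact hnn x
    have := ((h2.differentiableOn (by norm_num)).differentiableAt (hΩ.mem_nhds hyΩ)).hasFDerivAt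
    rwa [hmin.fderiv_eq_zero] at this
  have hl : HasDerivAt (fun t : ℝ => p + t • (y - p)) (y - p) 1 := by
    simpa using ((hasDerivAt_id (1 : ℝ)).smul_const (y - p)).const_add p
  have hg : HasDerivAt (fun t : ℝ => φ (p + t • (y - p))) 0 1 :=
    HasFDerivAt.comp_hasDerivAt (1 : ℝ) (l := φ) (l' := 0) (by simpa using hfd) hl
  have hs := (hasDerivAt_iff_tendsto_slope.1 hg).mono_left
    (nhdsWithin_mono (t := {1}ᶜ) 1 fun s (hs : s ∈ Iio 1) => hs.ne)
  have hle : (0 : ℝ) ≤ -c := by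
    refine le_of_tendsto hs ?_
    filter_upwards [Ico_mem_nhdsLT (show (1 / 2 : ℝ) < 1 by norm_num)] with t ht
    have h1 := hcb y hyR t ⟨ht.1, ht.2.le⟩
    rw [slope_def_field, div_le_iff_of_neg (by linarith [ht.2])]
    simp only [one_smul, add_sub_cancel, hy0]
    linarith
  linarith

/-- The strong maximum principle. -/
lemma pos_of_lap_nonpos {φ : E3 → ℝ} {Ω : Set E3} (hΩ : IsOpen Ω) (hconn : IsPreconnected Ω)
    (hc : Continuous φ) (h2 : ContDiffOn ℝ 2 φ Ω) (hlap : ∀ x ∈ Ω, lap φ x ≤ 0)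
    (hnn : ∀ x, 0 ≤ φ x) {p : E3} (hp : p ∈ Ω) (hp0 : φ p ≠ 0) : ∀ x ∈ Ω, 0 < φ x := by
  by_contra! hne
  obtain ⟨z, hz, hz0⟩ := hne
  have key : ∀ x ∈ Ω, φ x = 0 → ∀ᶠ y in 𝓝 x, φ y = 0 := fun x hx hx0 =>
    eventually_eq_zero_of_lap_nonpos hΩ hc h2 hlap hnn hx hx0
  obtain ⟨x, -, hx1, hx2⟩ := hconn {x | φ x ≠ 0} {x | ∀ᶠ y in 𝓝 x, φ y = 0}
    (isOpen_ne_fun hc continuous_const) isOpen_setOfPred_eventually_nhds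
    (fun x hx => or_iff_not_imp_left.2 fun h => key x hx (not_not.1 h))
    ⟨p, hp, hp0⟩ ⟨z, hz, key z hz (le_antisymm hz0 (hnn z))⟩
  exact hx1 hx2.self_of_nhds

/-- If every ray from a point of `B` leaves `Ω` within a dilation factor `1 + a`, then the layer
which a dilation by `1 + a / n` moves out of `Ω` has volume at least `volume B / n`. -/
lemma volume_le_mul_volume_layer {Ω B N : Set E3}
    (hstar : ∀ s : ℝ, 1 ≤ s → ∀ x : E3, s • x ∈ Ω → x ∈ Ω) {a : ℝ} (ha : 0 ≤ a)
    (hBΩ : B ⊆ Ω) (hexit : ∀ x ∈ B, (1 + a) • x ∉ Ω)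
    (hN : ∀ x ∈ B, ∀ t ∈ Icc 1 (1 + a), t • x ∈ N) {n : ℕ} (hn : n ≠ 0) :
    volume B ≤ n * volume ((Ω \ {x | (1 + a / n) • x ∈ Ω}) ∩ N) := by
  classical
  set s : ℝ := 1 + a / n with hs
  have hn0 : (0 : ℝ) < n := by positivity
  have hs1 : 1 ≤ s := by rw [hs]; linarith [div_nonneg ha hn0.le]
  have hmono : ∀ {b t : ℝ} {x : E3}, 0 < b → b ≤ t → t • x ∈ Ω → b • x ∈ Ω := by
    intro b t x hb hbt h
    refine hstar (t / b) ((one_le_div hb).2 hbt) _ ?_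
    rwa [smul_smul, div_mul_cancel₀ _ hb.ne']
  have hsn : 1 + a ≤ s ^ n := by
    have := one_add_mul_le_pow (a := a / n) (by linarith [div_nonneg ha hn0.le]) n
    rwa [mul_div_cancel₀ _ hn0.ne'] at this
  set T := (Ω \ {x | s • x ∈ Ω}) ∩ N with hT
  have hcover : B ⊆ ⋃ k ∈ Finset.range n, (fun x : E3 => s ^ k • x) ⁻¹' T := by
    intro x hx
    have hex : ∃ k : ℕ, s ^ k • x ∉ Ω :=
      ⟨n, fun h => hexit x hx (hmono (by linarith) hsn h)⟩
    have h0 : Nat.find hex ≠ 0 := fun h => by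
      have := Nat.find_spec hex
      rw [h, pow_zero, one_smul] at this
      exact this (hBΩ hx)
    obtain ⟨k, hk⟩ := Nat.exists_eq_succ_of_ne_zero h0
    have hkn : k < n := by
      have : Nat.find hex ≤ n := Nat.find_min' hex
        fun h => hexit x hx (hmono (by linarith) hsn h)
      omega
    have hin : s ^ k • x ∈ Ω := by
      by_contra h
      have := Nat.find_min' hex h
      omega
    have hout : s ^ (k + 1) • x ∉ Ω := by
      have := Nat.find_spec hex
      rwa [hk] at this
    have hlt : s ^ k ≤ 1 + a := by
      by_contra! h
      exact hexit x hx (hmono (by linarith) h.le hin)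
    simp only [mem_iUnion, Finset.mem_range]
    refine ⟨k, hkn, ⟨hin, fun h => hout ?_⟩, hN x hx _ ⟨one_le_pow₀ hs1, hlt⟩⟩
    rw [pow_succ', mul_smul]
    exact h
  refine (measure_mono hcover).trans ((measure_biUnion_finset_le _ _).trans ?_)
  have hk : ∀ k ∈ Finset.range n, volume ((fun x : E3 => s ^ k • x) ⁻¹' T) ≤ volume T := by
    intro k _
    have hsk : 1 ≤ s ^ k := one_le_pow₀ hs1
    rw [Measure.addHaar_preimage_smul _ (by positivity)]
    refine mul_le_of_le_one_left zero_le ?_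
    rw [ENNReal.ofReal_le_one, abs_of_nonneg (by positivity)]
    exact inv_le_one_of_one_le₀ (one_le_pow₀ hsk)
  exact (Finset.sum_le_card_nsmul _ _ _ hk).trans (by simp)

/-- A function satisfying the assumptions of the Hopf lemma at a nearest boundary point has a
strictly negative radial derivative near that point. -/
lemma exists_fderiv_self_neg {φ : E3 → ℝ} {Ω : Set E3} (hΩ : IsOpen Ω)
    (hb : Bornology.IsBounded Ω) (h0 : (0 : E3) ∈ Ω) (hφ : DirichletFun Ω φ)
    (hlap : ∀ x ∈ Ω, lap φ x ≤ 0) (hnn : ∀ x, 0 ≤ φ x) (hpos : ∀ x ∈ Ω, 0 < φ x)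
    (hlim : ∀ x ∈ closure Ω, ∃ ℓ, Tendsto (fderiv ℝ φ) (𝓝[Ω] x) (𝓝 ℓ)) :
    ∃ x₀ ∉ Ω, ∃ c > 0, ∃ ρ > 0, (∀ t ∈ Ico (0 : ℝ) 1, t • x₀ ∈ Ω) ∧
      ∀ x ∈ Ω ∩ ball x₀ ρ, fderiv ℝ φ x x < -c := by
  have hne : Ωᶜ.Nonempty := nonempty_compl.2 fun h =>
    NormedSpace.unbounded_univ ℝ E3 (h ▸ hb)
  obtain ⟨x₀, hx₀, hd⟩ := hΩ.isClosed_compl.exists_infDist_eq_dist hne 0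
  rw [dist_zero_left] at hd
  set r := ‖x₀‖ with hr
  have hr0 : 0 < r := norm_pos_iff.2 fun h => hx₀ (h ▸ h0)
  have hball : ball (0 : E3) r ⊆ Ω := fun x hx => by
    by_contra hxΩ
    have h1 := infDist_le_dist_of_mem (x := (0 : E3)) (show x ∈ Ωᶜ from hxΩ)
    rw [hd, dist_comm] at h1
    exact absurd h1 (not_le.2 hx)
  have hray : ∀ t ∈ Ico (0 : ℝ) 1, t • x₀ ∈ Ω := fun t ht => hball <| by
    rw [mem_ball_zero_iff, norm_smul, Real.norm_of_nonneg ht.1]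
    exact mul_lt_of_lt_one_left hr0 ht.2
  have hcl : x₀ ∈ closure Ω := closure_mono hball <| by
    rw [closure_ball _ hr0.ne']
    simp [hr]
  have hφ1 : ContDiffOn ℝ 1 φ Ω := hφ.c2.of_le (by norm_num)
  obtain ⟨c, hc, hcb⟩ := hopf_ball hr0 hφ.cont (hφ.c2.mono hball) (fun x hx => hlap x (hball hx))
    (fun x hx => hpos x (hball hx)) hnn
  obtain ⟨ℓ, hℓ⟩ := hlim x₀ hcl
  have hid : Tendsto (fun x : E3 => x) (𝓝[Ω] x₀) (𝓝 x₀) := tendsto_id.mono_left nhdsWithin_le_nhds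
  have happ : Continuous fun p : (E3 →L[ℝ] ℝ) × E3 => p.1 p.2 :=
    isBoundedBilinearMap_apply.continuous
  have hℓc : ℓ x₀ ≤ -c := by
    by_contra! hlt
    have hev := ((happ.tendsto (ℓ, x₀)).comp
      (hℓ.prodMk_nhds (tendsto_const_nhds (x := x₀)))).eventually_const_lt hlt
    have hev' : ∀ᶠ x in 𝓝 x₀, x ∈ Ω → -c < fderiv ℝ φ x x₀ := eventually_nhdsWithin_iff.1 hev
    obtain ⟨η, hη, hηb⟩ := Metric.eventually_nhds_iff_ball.1 hev'
    set t := max (1 / 2) (1 - η / r) with ht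
    have ht1 : t < 1 := max_lt (by norm_num) (by linarith [div_pos hη hr0])
    have ht2 : 1 / 2 ≤ t := le_max_left _ _
    have ht3 : 1 - η / r ≤ t := le_max_right _ _
    obtain ⟨τ, hτ, hτd⟩ := exists_hasDerivAt_eq_slope (fun t : ℝ => φ (t • x₀))
      (fun t => fderiv ℝ φ (t • x₀) x₀) ht1
      (hφ.cont.comp (by fun_prop : Continuous fun t : ℝ => t • x₀)).continuousOn
      fun τ hτ => hasDerivAt_ray hΩ hφ1 x₀ (hray τ ⟨by linarith [hτ.1], hτ.2⟩)
    have hτΩ := hray τ ⟨by linarith [hτ.1], hτ.2⟩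
    have hτη : τ • x₀ ∈ ball x₀ η := by
      have e : τ • x₀ - x₀ = -((1 - τ) • x₀) := by module
      rw [mem_ball_iff_norm, e, norm_neg, norm_smul, Real.norm_of_nonneg (by linarith [hτ.2]),
        ← lt_div_iff₀ hr0]
      linarith [hτ.1]
    have h1 := hηb _ hτη hτΩ
    have h2 := hcb x₀ (by simp [hr]) t ⟨ht2, ht1.le⟩
    simp only [zero_add, sub_zero] at h2
    rw [hτd, lt_div_iff₀ (by linarith), one_smul, hφ.zero x₀ hx₀] at h1
    linarith
  have hev := ((happ.tendsto (ℓ, x₀)).comp (hℓ.prodMk_nhds hid)).eventually_lt_const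
    (show ℓ x₀ < -(c / 2) by linarith)
  have hev' : ∀ᶠ x in 𝓝 x₀, x ∈ Ω → fderiv ℝ φ x x < -(c / 2) := eventually_nhdsWithin_iff.1 hev
  obtain ⟨ρ, hρ, hρb⟩ := Metric.eventually_nhds_iff_ball.1 hev'
  exact ⟨x₀, hx₀, c / 2, half_pos hc, ρ, hρ, hray, fun x hx => hρb x hx.2 hx.1⟩

lemma sq_fderiv_self_le (φ : E3 → ℝ) (x : E3) :
    (fderiv ℝ φ x x) ^ 2 ≤ gradSq φ x * ‖x‖ ^ 2 := by
  rw [fderiv_apply_eq_sum, EuclideanSpace.real_norm_sq_eq]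
  exact Finset.sum_mul_sq_le_sq_mul_sq _ _ _

/-- A positive superharmonic function cannot have negligible Dirichlet energy in the boundary
layers removed by dilations. -/
lemma eq_zero_of_eventually_layer_le {φ : E3 → ℝ} {Ω : Set E3} (hΩ : IsOpen Ω)
    (hb : Bornology.IsBounded Ω) (h0 : (0 : E3) ∈ Ω) (hconn : IsPreconnected Ω)
    (hstar : ∀ s : ℝ, 1 ≤ s → ∀ x : E3, s • x ∈ Ω → x ∈ Ω) (hφ : DirichletFun Ω φ)
    (hlap : ∀ x ∈ Ω, lap φ x ≤ 0)
    (hlim : ∀ x ∈ closure Ω, ∃ ℓ, Tendsto (fderiv ℝ φ) (𝓝[Ω] x) (𝓝 ℓ))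
    (hlayer : ∀ ε > 0, ∀ᶠ s in 𝓝[>] (1 : ℝ),
      ∫ x in Ω \ {x | s • x ∈ Ω}, gradSq φ x ≤ ε * (s - 1)) :
    ∀ x ∈ Ω, φ x = 0 := by
  have hnn : ∀ x, 0 ≤ φ x := fun x => by
    by_cases hx : x ∈ Ω
    · exact nonneg_of_lap_nonpos hΩ hb hφ.cont.continuousOn hφ.c2 hlap
        (fun y hy => (hφ.zero y (by rw [hΩ.frontier_eq] at hy; exact hy.2)).ge) x hx
    · exact (hφ.zero x hx).ge
  by_contra! hne
  obtain ⟨p, hp, hp0⟩ := hne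
  have hpos := pos_of_lap_nonpos hΩ hconn hφ.cont hφ.c2 hlap hnn hp hp0
  obtain ⟨x₀, hx₀, c, hc, ρ, hρ, hray, hgrad⟩ :=
    exists_fderiv_self_neg hΩ hb h0 hφ hlap hnn hpos hlim
  have hφ1 : ContDiffOn ℝ 1 φ Ω := hφ.c2.of_le (by norm_num)
  obtain ⟨L, hL⟩ := hφ.grad_bdd
  obtain ⟨R, hR0, hR⟩ := hb.exists_pos_norm_le
  set a : ℝ := min 1 (ρ / 2 / R) with ha
  have ha0 : 0 < a := lt_min one_pos (by positivity)
  have ha1 : a ≤ 1 := min_le_left _ _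
  have haR : a * R ≤ ρ / 2 := (le_div_iff₀ hR0).1 (min_le_right _ _)
  set B : Set E3 := Ω ∩ (ball x₀ (ρ / 2) ∩ {x | φ x < a * (c / 2)}) with hB
  have hVo : IsOpen (ball x₀ (ρ / 2) ∩ {x | φ x < a * (c / 2)}) :=
    isOpen_ball.inter (isOpen_lt hφ.cont continuous_const)
  have hBne : B.Nonempty := by
    have hx₀V : x₀ ∈ ball x₀ (ρ / 2) ∩ {x | φ x < a * (c / 2)} := by
      refine ⟨mem_ball_self (half_pos hρ), ?_⟩
      rw [mem_ofPred_eq, hφ.zero x₀ hx₀]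
      positivity
    have ht : Tendsto (fun t : ℝ => t • x₀) (𝓝[<] 1) (𝓝 x₀) := by
      have : Continuous fun t : ℝ => t • x₀ := by fun_prop
      simpa using (this.tendsto 1).mono_left nhdsWithin_le_nhds
    obtain ⟨t, ht1, ht2⟩ := ((ht.eventually_mem (hVo.mem_nhds hx₀V)).and
      (Ico_mem_nhdsLT (show (0 : ℝ) < 1 by norm_num))).exists
    exact ⟨t • x₀, hray t ht2, ht1⟩
  have hBvol : 0 < volume B := (hΩ.inter hVo).measure_pos volume hBne
  have hN : ∀ x ∈ B, ∀ t ∈ Icc 1 (1 + a), t • x ∈ ball x₀ ρ := by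
    intro x hx t ht
    have h1 : ‖x - x₀‖ < ρ / 2 := mem_ball_iff_norm.1 hx.2.1
    have e : t • x - x₀ = (t - 1) • x + (x - x₀) := by module
    rw [mem_ball_iff_norm, e]
    refine (norm_add_le _ _).trans_lt ?_
    rw [norm_smul, Real.norm_of_nonneg (by linarith [ht.1])]
    have h2 : (t - 1) * ‖x‖ ≤ a * R :=
      mul_le_mul (by linarith [ht.2]) (hR x hx.1) (norm_nonneg _) ha0.le
    linarith
  have hexit : ∀ x ∈ B, (1 + a) • x ∉ Ω := by
    intro x hx hmem
    have hin : ∀ t ∈ Icc 1 (1 + a), t • x ∈ Ω := fun t ht => by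
      have ht0 : 0 < t := by linarith [ht.1]
      refine hstar ((1 + a) / t) ((one_le_div ht0).2 ht.2) _ ?_
      rwa [smul_smul, div_mul_cancel₀ _ ht0.ne']
    obtain ⟨t, ht, htd⟩ := exists_hasDerivAt_eq_slope (fun t : ℝ => φ (t • x))
      (fun t => fderiv ℝ φ (t • x) x) (show (1 : ℝ) < 1 + a by linarith)
      (hφ.cont.comp (by fun_prop : Continuous fun t : ℝ => t • x)).continuousOn
      fun t ht => hasDerivAt_ray hΩ hφ1 x (hin t (Ioo_subset_Icc_self ht))
    have hti := Ioo_subset_Icc_self ht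
    have h1 := hgrad (t • x) ⟨hin t hti, hN x hx t hti⟩
    rw [map_smul, smul_eq_mul] at h1
    have h2 : fderiv ℝ φ (t • x) x < -(c / 2) := by
      by_contra! h
      nlinarith [ht.1, ht.2]
    rw [htd, one_smul, add_sub_cancel_left, div_lt_iff₀ ha0] at h2
    have h3 : φ x < a * (c / 2) := hx.2.2
    linarith [hnn ((1 + a) • x)]
  set κ : ℝ := c ^ 2 / R ^ 2 with hκ
  have hκ0 : 0 < κ := by positivity
  have hlow : ∀ x ∈ Ω ∩ ball x₀ ρ, κ ≤ gradSq φ x := by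
    intro x hx
    rw [hκ, div_le_iff₀ (by positivity)]
    have h1 := hgrad x hx
    have h2 := sq_fderiv_self_le φ x
    have h3 : gradSq φ x * ‖x‖ ^ 2 ≤ gradSq φ x * R ^ 2 := by
      gcongr
      · exact gradSq_nonneg φ x
      · exact hR x hx.1
    nlinarith
  have hBfin : volume B ≠ ⊤ := ((hb.subset inter_subset_left).measure_lt_top).ne
  set β : ℝ := volume.real B with hβ
  have hβ0 : 0 < β := ENNReal.toReal_pos hBvol.ne' hBfin
  set ε : ℝ := κ * β / (2 * a) with hε
  have hε0 : 0 < ε := by positivity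
  have hseq : Tendsto (fun n : ℕ => 1 + a / (n : ℝ)) atTop (𝓝[>] 1) := by
    refine tendsto_nhdsWithin_iff.2 ⟨?_, ?_⟩
    · simpa using (tendsto_const_div_atTop_nhds_zero_nat a).const_add 1
    · filter_upwards [eventually_gt_atTop 0] with n hn
      have : (0 : ℝ) < n := by exact_mod_cast hn
      rw [mem_Ioi]
      linarith [div_pos ha0 this]
  obtain ⟨n, hn, hnpos⟩ := ((hseq.eventually (hlayer ε hε0)).and (eventually_gt_atTop 0)).exists
  have hn0 : (0 : ℝ) < n := by exact_mod_cast hnpos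
  set D : Set E3 := Ω \ {x | (1 + a / (n : ℝ)) • x ∈ Ω} with hD
  have hDm : MeasurableSet D := hΩ.measurableSet.diff
    (hΩ.preimage (by fun_prop : Continuous fun x : E3 => (1 + a / (n : ℝ)) • x)).measurableSet
  have hDN : D ∩ ball x₀ ρ ⊆ Ω := fun x hx => hx.1.1
  have hDfin : volume (D ∩ ball x₀ ρ) ≠ ⊤ := ((hb.subset hDN).measure_lt_top).ne
  have hvol : β ≤ n * volume.real (D ∩ ball x₀ ρ) := by
    have h := volume_le_mul_volume_layer hstar ha0.le inter_subset_left hexit hN hnpos.ne'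
    have := ENNReal.toReal_mono (ENNReal.mul_ne_top (ENNReal.natCast_ne_top n) hDfin) h
    rwa [ENNReal.toReal_mul, ENNReal.toReal_natCast] at this
  have iφ := integrableOn_gradSq hΩ hb hφ1 hL
  have hint : κ * volume.real (D ∩ ball x₀ ρ) ≤ ∫ x in D, gradSq φ x := by
    calc κ * volume.real (D ∩ ball x₀ ρ) = ∫ _ in D ∩ ball x₀ ρ, κ := by
          rw [setIntegral_const, smul_eq_mul, mul_comm]
      _ ≤ ∫ x in D ∩ ball x₀ ρ, gradSq φ x :=
          setIntegral_mono_on (integrableOn_const hDfin) (iφ.mono_set hDN)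
            (hDm.inter measurableSet_ball) fun x hx => hlow x ⟨hx.1.1, hx.2⟩
      _ ≤ ∫ x in D, gradSq φ x :=
          setIntegral_mono_set (iφ.mono_set sdiff_subset)
            (Eventually.of_forall fun x => gradSq_nonneg φ x) inter_subset_left.eventuallyLE
  have h1 : κ * volume.real (D ∩ ball x₀ ρ) ≤ ε * (a / n) := by
    rw [add_sub_cancel_left] at hn
    exact hint.trans hn
  have h2 : ε * (a / n) * n = κ * β / 2 := by
    rw [hε]
    field_simp
  have h3 : κ * β ≤ κ * volume.real (D ∩ ball x₀ ρ) * n := by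
    rw [mul_assoc, mul_comm _ (n : ℝ)]
    gcongr
  nlinarith [mul_le_mul_of_nonneg_right h1 hn0.le, mul_pos hκ0 hβ0]

/-- Nonexistence for `λ ≤ 0` on a bounded domain which is star-shaped with respect to the
origin: the system `-Δu = λu + q|u|³u·φ`, `-Δφ = q|u|⁵` in `Ω` with `u = φ = 0` on `∂Ω`
has no nontrivial classical solution (`u, φ` being `C²` in `Ω` and `C¹` up to the boundary). -/
theorem nonexistence_nonpositive_lambda (Ω : Set E3) (hΩo : IsOpen Ω)
    (hΩb : Bornology.IsBounded Ω) (hΩs : StarConvex ℝ 0 Ω)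
    (q lam : ℝ) (hq : 0 < q) (hlam : lam ≤ 0) (u φ : E3 → ℝ)
    (hu2 : ContDiffOn ℝ 2 u Ω) (hφ2 : ContDiffOn ℝ 2 φ Ω)
    (hu1 : ContDiffOn ℝ 1 u (closure Ω)) (hφ1 : ContDiffOn ℝ 1 φ (closure Ω))
    (hueq : ∀ x ∈ Ω, -lap u x = lam * u x + q * |u x| ^ 3 * u x * φ x)
    (hφeq : ∀ x ∈ Ω, -lap φ x = q * |u x| ^ 5)
    (hub : ∀ x ∈ frontier Ω, u x = 0) (hφb : ∀ x ∈ frontier Ω, φ x = 0) :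
    (∀ x ∈ closure Ω, u x = 0) ∧ (∀ x ∈ closure Ω, φ x = 0) := by
  rcases Ω.eq_empty_or_nonempty with rfl | hne
  · simp
  have h0 : (0 : E3) ∈ Ω := hΩs.mem hne
  have hconn : IsPreconnected Ω := (hΩs.isPathConnected h0).isConnected.isPreconnected
  have hstar : ∀ s : ℝ, 1 ≤ s → ∀ x : E3, s • x ∈ Ω → x ∈ Ω := fun s hs x hx => by
    have hs0 : 0 < s := by linarith
    have := hΩs.smul_mem hx (inv_nonneg.2 hs0.le) (inv_le_one_of_one_le₀ hs)
    rwa [smul_smul, inv_mul_cancel₀ hs0.ne', one_smul] at this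
  have hcu := hu1.continuousOn
  have hcφ := hφ1.continuousOn
  have hbdd : ∀ {f g : E3 → ℝ}, ContinuousOn g (closure Ω) → (∀ x ∈ Ω, -lap f x = g x) →
      ∃ M, ∀ x ∈ Ω, |lap f x| ≤ M := fun {f g} hg h => by
    obtain ⟨M, hM⟩ := hΩb.isCompact_closure.exists_bound_of_continuousOn hg
    refine ⟨M, fun x hx => ?_⟩
    rw [← abs_neg, h x hx]
    exact hM x (subset_closure hx)
  have hU := dirichletFun_indicator hΩo hΩb hu2 hu1 hub (hbdd (by fun_prop) hueq)
  have hΦ := dirichletFun_indicator hΩo hΩb hφ2 hφ1 hφb (hbdd (by fun_prop) hφeq)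
  have hlapΦ : ∀ x ∈ Ω, lap (Ω.indicator φ) x = lap φ x := fun x hx =>
    lap_congr (indicator_eventuallyEq_self hΩo hx)
  have hUeq : ∀ x ∈ Ω, -lap (Ω.indicator u) x = lam * Ω.indicator u x
      + q * |Ω.indicator u x| ^ 3 * Ω.indicator u x * Ω.indicator φ x := fun x hx => by
    rw [lap_congr (indicator_eventuallyEq_self hΩo hx), indicator_of_mem hx, indicator_of_mem hx]
    exact hueq x hx
  have hΦeq : ∀ x ∈ Ω, -lap (Ω.indicator φ) x = q * |Ω.indicator u x| ^ 5 := fun x hx => by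
    rw [hlapΦ x hx, indicator_of_mem hx]
    exact hφeq x hx
  have hφ0 : ∀ x ∈ Ω, φ x = 0 := fun x hx => by
    have h := eq_zero_of_eventually_layer_le hΩo hΩb h0 hconn hstar hΦ
      (fun x hx => by
        have : 0 ≤ q * |Ω.indicator u x| ^ 5 := by positivity
        linarith [hΦeq x hx])
      (fun x hx => by
        obtain ⟨ℓ, hℓ⟩ := exists_tendsto_fderiv hΩo hφ1 hx
        refine ⟨ℓ, hℓ.congr' ?_⟩
        filter_upwards [self_mem_nhdsWithin] with y hy
        exact (indicator_eventuallyEq_self hΩo hy).fderiv_eq.symm)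
      (fun ε hε => eventually_setIntegral_gradSq_le hΩo hΩb hstar hlam hU hΦ hUeq hΦeq hε) x hx
    rwa [indicator_of_mem hx] at h
  have hu0 : ∀ x ∈ Ω, u x = 0 := fun x hx => by
    have hl : lap φ x = 0 := by
      have : φ =ᶠ[𝓝 x] fun _ => 0 := eventuallyEq_of_mem (hΩo.mem_nhds hx) hφ0
      rw [lap_congr this]
      simp [lap]
    have h := hφeq x hx
    rw [hl, neg_zero, zero_eq_mul] at h
    simpa using h.resolve_left hq.ne'
  rw [closure_eq_self_union_frontier]
  exact ⟨fun x hx => hx.elim (hu0 x) (hub x), fun x hx => hx.elim (hφ0 x) (hφb x)⟩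
end
end

section
/- Let R > 0, q > 0, λ ∈ ℝ, and let (u, φ) be a classical solution of problem (P) with u and φ C² on B_R and C¹ on B̄_R. Then the energy F(u, φ) = (1/2)∫_{B_R}|∇u|² − (λ/2)∫_{B_R}u² − (q/5)∫_{B_R}|u|⁵φ + (1/10)∫_{B_R}|∇φ|² satisfies F(u, φ) = (2/5)(∫_{B_R}|∇u|² − λ∫_{B_R}u²). -/
open Metric Real Set

noncomputable section

/-- The energy functional
`F(u, φ) = ½∫|∇u|² − (λ/2)∫u² − (q/5)∫|u|⁵φ + (1/10)∫|∇φ|²` over `B_R`. -/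
def energyF (R q lam : ℝ) (u φ : E3 → ℝ) : ℝ :=
  (1 / 2) * (∫ x in ball (0:E3) R, ‖gradient u x‖ ^ 2)
    - lam / 2 * (∫ x in ball (0:E3) R, (u x) ^ 2)
    - q / 5 * (∫ x in ball (0:E3) R, |u x| ^ 5 * φ x)
    + (1 / 10) * (∫ x in ball (0:E3) R, ‖gradient φ x‖ ^ 2)

open MeasureTheory Filter Topology

lemma norm_sq_gradient_eq_sum (f : E3 → ℝ) (x : E3) :
    ‖gradient f x‖ ^ 2 = ∑ i : Fin 3, (fderiv ℝ f x (EuclideanSpace.single i 1)) ^ 2 := by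
  rw [EuclideanSpace.real_norm_sq_eq]
  refine Finset.sum_congr rfl fun i _ => ?_
  rw [← inner_gradient_left, EuclideanSpace.inner_single_right]
  simp

lemma integral_fderiv_apply_eq_zero {V : E3 → ℝ} (hV : ContDiff ℝ 1 V)
    (hc : HasCompactSupport V) (v : E3) : ∫ x, fderiv ℝ V x v = 0 := by
  have hi : Integrable (fun x => fderiv ℝ V x v) :=
    ((hV.continuous_fderiv one_ne_zero).clm_apply continuous_const).integrable_of_hasCompactSupport
      (hc.fderiv_apply ℝ v)
  have h := integral_mul_fderiv_eq_neg_fderiv_mul_of_integrable (μ := (volume : Measure E3))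
    (f := fun _ : E3 => (1 : ℝ)) (g := V) (v := v) (by simp) (by simpa using hi)
    (by simpa using hV.continuous.integrable_of_hasCompactSupport hc) (by simp)
    (fun x _ => hV.differentiable one_ne_zero x)
  simpa using h

lemma deriv_smoothTransition_eq_zero {t : ℝ} (ht : t ∉ Icc (0 : ℝ) 1) :
    deriv smoothTransition t = 0 := by
  rw [mem_Icc, not_and_or, not_le, not_le] at ht
  rcases ht with h | h
  · have : smoothTransition =ᶠ[𝓝 t] fun _ => 0 := by
      filter_upwards [Iio_mem_nhds h] with s hs
      exact smoothTransition.zero_of_nonpos (le_of_lt hs)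
    simp [this.deriv_eq]
  · have : smoothTransition =ᶠ[𝓝 t] fun _ => 1 := by
      filter_upwards [Ioi_mem_nhds h] with s hs
      exact smoothTransition.one_of_one_le (le_of_lt hs)
    simp [this.deriv_eq]

lemma exists_bound_deriv_smoothTransition :
    ∃ M : ℝ, 0 ≤ M ∧ ∀ t, |deriv smoothTransition t| ≤ M := by
  obtain ⟨M, hM⟩ := Continuous.bounded_above_of_compact_support
    ((smoothTransition.contDiff (n := 1)).continuous_deriv le_rfl)
    (HasCompactSupport.intro isCompact_Icc fun _ => deriv_smoothTransition_eq_zero)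
  exact ⟨M, (norm_nonneg _).trans (hM 0), hM⟩

/-- A smooth radial cutoff, equal to `1` where `2 ≤ n (R² - |x|²)` and to `0` where
`n (R² - |x|²) ≤ 1`. -/
def radialCutoff (R n : ℝ) (x : E3) : ℝ := smoothTransition (n * (R ^ 2 - ‖x‖ ^ 2) - 1)

lemma contDiff_radialCutoff (R n : ℝ) {k : ℕ∞} : ContDiff ℝ k (radialCutoff R n) :=
  smoothTransition.contDiff.comp
    ((contDiff_const.mul (contDiff_const.sub (contDiff_norm_sq ℝ))).sub contDiff_const)

lemma fderiv_radialCutoff (R n : ℝ) (x : E3) (i : Fin 3) :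
    fderiv ℝ (radialCutoff R n) x (EuclideanSpace.single i 1)
      = deriv smoothTransition (n * (R ^ 2 - ‖x‖ ^ 2) - 1) * (n * (-(2 * x i))) := by
  have h1 : HasDerivAt smoothTransition
      (deriv smoothTransition (n * (R ^ 2 - ‖x‖ ^ 2) - 1)) (n * (R ^ 2 - ‖x‖ ^ 2) - 1) :=
    ((smoothTransition.contDiff (n := 1)).differentiable one_ne_zero _).hasDerivAt
  have h2 := ((((hasStrictFDerivAt_norm_sq x).hasFDerivAt).const_sub (R ^ 2)).const_mul
    n).sub_const 1
  have h3 : HasFDerivAt (radialCutoff R n) _ x := h1.comp_hasFDerivAt x h2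
  rw [h3.fderiv]
  simp [EuclideanSpace.inner_single_right]

lemma radialCutoff_nonneg (R n : ℝ) (x : E3) : 0 ≤ radialCutoff R n x :=
  smoothTransition.nonneg _

lemma radialCutoff_le_one (R n : ℝ) (x : E3) : radialCutoff R n x ≤ 1 :=
  smoothTransition.le_one _

lemma radialCutoff_eq_zero {R n : ℝ} {x : E3} (h : n * (R ^ 2 - ‖x‖ ^ 2) ≤ 1) :
    radialCutoff R n x = 0 :=
  smoothTransition.zero_of_nonpos (by linarith)

lemma radialCutoff_eq_one {R n : ℝ} {x : E3} (h : 2 ≤ n * (R ^ 2 - ‖x‖ ^ 2)) :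
    radialCutoff R n x = 1 :=
  smoothTransition.one_of_one_le (by linarith)

lemma exists_bound_fderiv_of_contDiffOn_closedBall {R : ℝ} (hR : 0 < R) {f : E3 → ℝ}
    (hf : ContDiffOn ℝ 1 f (closedBall 0 R)) :
    ∃ L : ℝ, 0 ≤ L ∧ (∀ x ∈ ball (0 : E3) R, ‖fderiv ℝ f x‖ ≤ L) ∧
      ∀ x ∈ closedBall (0 : E3) R, ∀ y ∈ closedBall (0 : E3) R, ‖f y - f x‖ ≤ L * ‖y - x‖ := by
  have hconv : Convex ℝ (closedBall (0 : E3) R) := convex_closedBall 0 R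
  have hud : UniqueDiffOn ℝ (closedBall (0 : E3) R) := by
    refine uniqueDiffOn_convex hconv ⟨0, ball_subset_interior_closedBall ?_⟩
    simpa using hR
  obtain ⟨L, hL⟩ := (isCompact_closedBall (0 : E3) R).exists_bound_of_continuousOn
    (hf.continuousOn_fderivWithin hud le_rfl)
  refine ⟨L, (norm_nonneg _).trans (hL 0 (mem_closedBall_self hR.le)), fun x hx => ?_,
    fun x hx y hy => ?_⟩
  · rw [← fderivWithin_of_mem_nhds (mem_of_superset (isOpen_ball.mem_nhds hx)
      ball_subset_closedBall)]
    exact hL x (ball_subset_closedBall hx)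
  · exact hconv.norm_image_sub_le_of_norm_fderivWithin_le (hf.differentiableOn one_ne_zero) hL hx hy

lemma abs_le_mul_sub_norm {R : ℝ} (hR : 0 < R) {f : E3 → ℝ} {L : ℝ}
    (hL : ∀ x ∈ closedBall (0 : E3) R, ∀ y ∈ closedBall (0 : E3) R, ‖f y - f x‖ ≤ L * ‖y - x‖)
    (hb : ∀ x ∈ sphere (0 : E3) R, f x = 0) {x : E3} (hx : x ∈ ball (0 : E3) R) :
    |f x| ≤ L * (R - ‖x‖) := by
  have hxR : ‖x‖ < R := by simpa using hx
  obtain ⟨y, hy, hyx⟩ : ∃ y ∈ sphere (0 : E3) R, ‖x - y‖ = R - ‖x‖ := by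
    by_cases h0 : x = 0
    · refine ⟨EuclideanSpace.single 0 R, ?_, ?_⟩ <;> simp [h0, abs_of_pos hR]
    · have hx0 : 0 < ‖x‖ := norm_pos_iff.2 h0
      refine ⟨(R / ‖x‖) • x, ?_, ?_⟩
      · simp [norm_smul, abs_of_pos hR, hx0.ne']
      · have : x - (R / ‖x‖) • x = (1 - R / ‖x‖) • x := by rw [sub_smul, one_smul]
        rw [this, norm_smul, Real.norm_eq_abs, abs_of_nonpos]
        · field_simp
          ring
        · rw [sub_nonpos, le_div_iff₀ hx0]
          linarith
  have := hL y (sphere_subset_closedBall hy) x (ball_subset_closedBall hx)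
  rwa [hb y hy, sub_zero, hyx] at this

/-- The components of the field `χ f ∇f`, where `χ` is a radial cutoff. -/
def cutoffField (R n : ℝ) (f : E3 → ℝ) (i : Fin 3) (x : E3) : ℝ :=
  radialCutoff R n x * (f x * fderiv ℝ f x (EuclideanSpace.single i 1))

lemma contDiffAt_fderiv_apply {R : ℝ} {f : E3 → ℝ} (hf : ContDiffOn ℝ 2 f (ball 0 R)) {x : E3}
    (hx : x ∈ ball (0 : E3) R) (v : E3) : ContDiffAt ℝ 1 (fun y => fderiv ℝ f y v) x :=
  ((hf.contDiffAt (isOpen_ball.mem_nhds hx)).fderiv_right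
    (by norm_num [one_add_one_eq_two])).clm_apply contDiffAt_const

lemma cutoffField_eventuallyEq_zero {R n : ℝ} (hR : 0 < R) (hn : 0 ≤ n) (f : E3 → ℝ) (i : Fin 3)
    {x : E3} (hx : x ∉ ball (0 : E3) R) : cutoffField R n f i =ᶠ[𝓝 x] fun _ => 0 := by
  have hxR : R ≤ ‖x‖ := by simpa using hx
  have hcont : Continuous fun y : E3 => n * (R ^ 2 - ‖y‖ ^ 2) := by fun_prop
  have hlt : n * (R ^ 2 - ‖x‖ ^ 2) < 1 :=
    (mul_nonpos_of_nonneg_of_nonpos hn (by nlinarith)).trans_lt zero_lt_one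
  filter_upwards [hcont.continuousAt.eventually_lt_const hlt] with y hy
  simp [cutoffField, radialCutoff_eq_zero hy.le]

lemma contDiff_cutoffField {R n : ℝ} (hR : 0 < R) (hn : 0 ≤ n) {f : E3 → ℝ}
    (hf : ContDiffOn ℝ 2 f (ball 0 R)) (i : Fin 3) : ContDiff ℝ 1 (cutoffField R n f i) := by
  rw [contDiff_iff_contDiffAt]
  intro x
  by_cases hx : x ∈ ball (0 : E3) R
  · exact (contDiff_radialCutoff R n (k := 1)).contDiffAt.mul
      (((hf.contDiffAt (isOpen_ball.mem_nhds hx)).of_le one_le_two).mul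
        (contDiffAt_fderiv_apply hf hx _))
  · exact contDiffAt_const.congr_of_eventuallyEq (cutoffField_eventuallyEq_zero hR hn f i hx)

lemma hasCompactSupport_cutoffField {R n : ℝ} (hR : 0 < R) (hn : 0 ≤ n) (f : E3 → ℝ) (i : Fin 3) :
    HasCompactSupport (cutoffField R n f i) :=
  HasCompactSupport.intro (isCompact_closedBall (0 : E3) R) fun _ hx =>
    (cutoffField_eventuallyEq_zero hR hn f i
      fun h => hx (ball_subset_closedBall h)).eq_of_nhds

lemma sum_fderiv_cutoffField {R n : ℝ} {f : E3 → ℝ} (hf : ContDiffOn ℝ 2 f (ball 0 R)) {x : E3}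
    (hx : x ∈ ball (0 : E3) R) :
    ∑ i, fderiv ℝ (cutoffField R n f i) x (EuclideanSpace.single i 1)
      = radialCutoff R n x * (‖gradient f x‖ ^ 2 + f x * lap f x)
        + ∑ i : Fin 3, deriv smoothTransition (n * (R ^ 2 - ‖x‖ ^ 2) - 1) * (n * (-(2 * x i)))
          * (f x * fderiv ℝ f x (EuclideanSpace.single i 1)) := by
  have hterm (i : Fin 3) : fderiv ℝ (cutoffField R n f i) x (EuclideanSpace.single i 1)
      = radialCutoff R n x * (fderiv ℝ f x (EuclideanSpace.single i 1)) ^ 2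
        + radialCutoff R n x * (f x * fderiv ℝ (fun y => fderiv ℝ f y (EuclideanSpace.single i 1)) x
          (EuclideanSpace.single i 1))
        + deriv smoothTransition (n * (R ^ 2 - ‖x‖ ^ 2) - 1) * (n * (-(2 * x i)))
          * (f x * fderiv ℝ f x (EuclideanSpace.single i 1)) := by
    have h1 : DifferentiableAt ℝ (radialCutoff R n) x :=
      (contDiff_radialCutoff R n (k := 1)).differentiable one_ne_zero x
    have h2 : DifferentiableAt ℝ f x :=
      (hf.contDiffAt (isOpen_ball.mem_nhds hx)).differentiableAt two_ne_zero
    have h3 := (contDiffAt_fderiv_apply hf hx (EuclideanSpace.single i 1)).differentiableAt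
      one_ne_zero
    have h := (h1.hasFDerivAt.mul (h2.hasFDerivAt.mul h3.hasFDerivAt)).fderiv
    have hd : fderiv ℝ (cutoffField R n f i) x = _ := h
    rw [hd, ← fderiv_radialCutoff]
    simp only [add_apply, smul_apply, Pi.mul_apply, smul_eq_mul]
    ring
  simp_rw [hterm, norm_sq_gradient_eq_sum, lap, Finset.sum_add_distrib, mul_add, Finset.mul_sum]

lemma abs_deriv_smoothTransition_mul_le {R n M L r a : ℝ} (hR : 0 < R) (hn : 0 ≤ n) (hL : 0 ≤ L)
    (hM0 : 0 ≤ M) (hM : ∀ t, |deriv smoothTransition t| ≤ M) (hr : 0 ≤ r) (hrR : r < R)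
    (ha : |a| ≤ L * (R - r)) :
    |deriv smoothTransition (n * (R ^ 2 - r ^ 2) - 1)| * (n * |a|) ≤ M * (2 * L / R) := by
  by_cases ht : n * (R ^ 2 - r ^ 2) - 1 ∈ Icc (0 : ℝ) 1
  · refine mul_le_mul (hM _) ?_ (by positivity) hM0
    rw [le_div_iff₀ hR]
    have h1 : n * (R - r) * R ≤ 2 := by
      have : 0 ≤ n * (R - r) * r := by
        have := sub_pos.2 hrR
        positivity
      nlinarith [ht.2]
    calc n * |a| * R ≤ n * (L * (R - r)) * R := by gcongr
      _ = L * (n * (R - r) * R) := by ring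
      _ ≤ L * 2 := by gcongr
      _ = 2 * L := by ring
  · rw [deriv_smoothTransition_eq_zero ht]
    simp only [abs_zero, zero_mul]
    positivity

/-- Green's first identity on a ball for a function vanishing on the boundary. -/
theorem integral_norm_gradient_sq_eq {R : ℝ} (hR : 0 < R) {f g : E3 → ℝ}
    (hf2 : ContDiffOn ℝ 2 f (ball 0 R)) (hf1 : ContDiffOn ℝ 1 f (closedBall 0 R))
    (hg : ContinuousOn g (closedBall 0 R)) (hfg : ∀ x ∈ ball (0 : E3) R, -lap f x = g x)
    (hb : ∀ x ∈ sphere (0 : E3) R, f x = 0) :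
    ∫ x in ball (0 : E3) R, ‖gradient f x‖ ^ 2 = ∫ x in ball (0 : E3) R, f x * g x := by
  obtain ⟨L, hL0, hLd, hLip⟩ := exists_bound_fderiv_of_contDiffOn_closedBall hR hf1
  obtain ⟨M, hM0, hM⟩ := exists_bound_deriv_smoothTransition
  have hfgc : ContinuousOn (fun x => f x * g x) (closedBall 0 R) := hf1.continuousOn.mul hg
  obtain ⟨K, hK⟩ := (isCompact_closedBall (0 : E3) R).exists_bound_of_continuousOn hfgc
  have hpart (i : Fin 3) {x : E3} (hx : x ∈ ball (0 : E3) R) :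
      |fderiv ℝ f x (EuclideanSpace.single i 1)| ≤ L := by
    simpa using (fderiv ℝ f x).le_of_opNorm_le (hLd x hx) (EuclideanSpace.single i 1)
  have hgrad {x : E3} (hx : x ∈ ball (0 : E3) R) : ‖gradient f x‖ ^ 2 ≤ L ^ 2 := by
    have : ‖gradient f x‖ = ‖fderiv ℝ f x‖ := LinearIsometryEquiv.norm_map _ _
    rw [this]
    gcongr
    exact hLd x hx
  have hfin : volume (ball (0 : E3) R) ≠ ⊤ := measure_ball_lt_top.ne
  have hint1 : IntegrableOn (fun x => ‖gradient f x‖ ^ 2) (ball (0 : E3) R) := by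
    refine Measure.integrableOn_of_bounded (M := L ^ 2) hfin ?_ ?_
    · simp_rw [norm_sq_gradient_eq_sum]
      exact (Finset.measurable_sum _ fun i _ =>
        (measurable_fderiv_apply_const ℝ f _).pow_const 2).aestronglyMeasurable
    · filter_upwards [ae_restrict_mem measurableSet_ball] with x hx
      rw [Real.norm_of_nonneg (by positivity)]
      exact hgrad hx
  have hint2 : IntegrableOn (fun x => f x * g x) (ball (0 : E3) R) :=
    (hfgc.integrableOn_compact (isCompact_closedBall 0 R)).mono_set ball_subset_closedBall
  let G (n : ℕ) (x : E3) : ℝ :=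
    ∑ i, fderiv ℝ (cutoffField R n f i) x (EuclideanSpace.single i 1)
  have hGc (n : ℕ) (i : Fin 3) :
      Continuous fun x => fderiv ℝ (cutoffField R n f i) x (EuclideanSpace.single i 1) :=
    ((contDiff_cutoffField hR n.cast_nonneg hf2 i).continuous_fderiv one_ne_zero).clm_apply continuous_const
  have hG0 (n : ℕ) : ∫ x in ball (0 : E3) R, G n x = 0 := by
    have hout : ∀ x ∉ ball (0 : E3) R, G n x = 0 := fun x hx => by
      refine Finset.sum_eq_zero fun i _ => ?_
      simp [(cutoffField_eventuallyEq_zero hR n.cast_nonneg f i hx).fderiv_eq]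
    rw [setIntegral_eq_integral_of_forall_compl_eq_zero hout]
    have hcs (i : Fin 3) := hasCompactSupport_cutoffField hR n.cast_nonneg f i
    simp only [G]
    rw [integral_finsetSum _ fun i _ =>
      (hGc n i).integrable_of_hasCompactSupport ((hcs i).fderiv_apply ℝ _)]
    exact Finset.sum_eq_zero fun i _ => integral_fderiv_apply_eq_zero
      (contDiff_cutoffField hR n.cast_nonneg hf2 i) (hcs i) _
  have hG {n : ℕ} {x : E3} (hx : x ∈ ball (0 : E3) R) : G n x
      = radialCutoff R n x * (‖gradient f x‖ ^ 2 - f x * g x)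
        + ∑ i : Fin 3, deriv smoothTransition (n * (R ^ 2 - ‖x‖ ^ 2) - 1) * (n * (-(2 * x i)))
          * (f x * fderiv ℝ f x (EuclideanSpace.single i 1)) := by
    rw [← hfg x hx, mul_neg, sub_neg_eq_add]
    exact sum_fderiv_cutoffField hf2 hx
  have hlim : Tendsto (fun n => ∫ x in ball (0 : E3) R, G n x) atTop
      (𝓝 (∫ x in ball (0 : E3) R, (‖gradient f x‖ ^ 2 - f x * g x))) := by
    refine tendsto_integral_of_dominated_convergence
      (fun _ => (L ^ 2 + K) + ∑ i : Fin 3, M * (2 * L / R) * (2 * R * L)) ?_ ?_ ?_ ?_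
    · exact fun n => (continuous_finsetSum _ fun i _ => hGc n i).aestronglyMeasurable
    · exact integrableOn_const hfin
    · intro n
      filter_upwards [ae_restrict_mem measurableSet_ball] with x hx
      have hxR : ‖x‖ < R := by simpa using hx
      rw [hG hx]
      refine (norm_add_le _ _).trans (add_le_add ?_ ((norm_sum_le _ _).trans
        (Finset.sum_le_sum fun i _ => ?_)))
      · rw [norm_mul, Real.norm_of_nonneg (radialCutoff_nonneg _ _ _)]
        refine (mul_le_of_le_one_left (norm_nonneg _) (radialCutoff_le_one _ _ _)).trans ?_
        refine (norm_sub_le _ _).trans (add_le_add ?_ (hK x (ball_subset_closedBall hx)))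
        rw [Real.norm_of_nonneg (by positivity)]
        exact hgrad hx
      · have hxi : |x i| ≤ R := by
          simpa using (PiLp.norm_apply_le x i).trans hxR.le
        have h1 := abs_deriv_smoothTransition_mul_le hR (Nat.cast_nonneg n) hL0 hM0 hM
          (norm_nonneg x) hxR (abs_le_mul_sub_norm hR hLip hb hx)
        calc _ = |deriv smoothTransition (n * (R ^ 2 - ‖x‖ ^ 2) - 1)| * (n * |f x|)
              * (2 * |x i| * |fderiv ℝ f x (EuclideanSpace.single i 1)|) := by
              simp only [norm_mul, norm_neg, Real.norm_eq_abs, Nat.abs_cast, Nat.abs_ofNat]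
              ring
          _ ≤ M * (2 * L / R) * (2 * R * L) := by
              gcongr
              exact hpart i hx
    · filter_upwards [ae_restrict_mem measurableSet_ball] with x hx
      have hxR : ‖x‖ < R := by simpa using hx
      have hpos : 0 < R ^ 2 - ‖x‖ ^ 2 := by nlinarith [norm_nonneg x]
      refine tendsto_const_nhds.congr' ?_
      have := (tendsto_natCast_atTop_atTop (R := ℝ)).atTop_mul_const hpos
      filter_upwards [this.eventually_gt_atTop 2] with n hn
      rw [hG hx, radialCutoff_eq_one hn.le,
        deriv_smoothTransition_eq_zero fun h => by linarith [h.2]]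
      simp
  simp_rw [hG0] at hlim
  have h0 := tendsto_nhds_unique hlim tendsto_const_nhds
  rw [integral_sub hint1 hint2] at h0
  linarith

/-- For a classical solution `(u, φ)` of problem (P) on `B_R` which is `C²` in `B_R` and `C¹`
up to the boundary, `F(u, φ) = (2/5)(∫|∇u|² − λ∫u²)`. -/
theorem energy_of_solution (R q lam : ℝ) (hR : 0 < R) (hq : 0 < q) (u φ : E3 → ℝ)
    (hu2 : ContDiffOn ℝ 2 u (ball 0 R)) (hu1 : ContDiffOn ℝ 1 u (closedBall 0 R))
    (hφ2 : ContDiffOn ℝ 2 φ (ball 0 R)) (hφ1 : ContDiffOn ℝ 1 φ (closedBall 0 R))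
    (hueq : ∀ x ∈ ball (0:E3) R, -lap u x = lam * u x + q * |u x| ^ 3 * u x * φ x)
    (hφeq : ∀ x ∈ ball (0:E3) R, -lap φ x = q * |u x| ^ 5)
    (hub : ∀ x ∈ sphere (0:E3) R, u x = 0) (hφb : ∀ x ∈ sphere (0:E3) R, φ x = 0) :
    energyF R q lam u φ
      = 2 / 5 * ((∫ x in ball (0:E3) R, ‖gradient u x‖ ^ 2)
          - lam * ∫ x in ball (0:E3) R, (u x) ^ 2) := by
  have hu := hu1.continuousOn
  have hφ := hφ1.continuousOn
  have hA := integral_norm_gradient_sq_eq hR hu2 hu1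
    (g := fun x => lam * u x + q * |u x| ^ 3 * u x * φ x) (by fun_prop) hueq hub
  have hC := integral_norm_gradient_sq_eq hR hφ2 hφ1
    (g := fun x => q * |u x| ^ 5) (by fun_prop) hφeq hφb
  have hsub := ball_subset_closedBall (x := (0 : E3)) (ε := R)
  have hi1 : IntegrableOn (fun x => lam * (u x) ^ 2) (ball (0 : E3) R) :=
    (ContinuousOn.integrableOn_compact (isCompact_closedBall 0 R) (by fun_prop)).mono_set hsub
  have hi2 : IntegrableOn (fun x => q * (|u x| ^ 5 * φ x)) (ball (0 : E3) R) :=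
    (ContinuousOn.integrableOn_compact (isCompact_closedBall 0 R) (by fun_prop)).mono_set hsub
  have e1 : (fun x => u x * (lam * u x + q * |u x| ^ 3 * u x * φ x))
      = fun x => lam * (u x) ^ 2 + q * (|u x| ^ 5 * φ x) := by
    funext x
    linear_combination (-q * |u x| ^ 3 * φ x) * sq_abs (u x)
  have e2 : (fun x => φ x * (q * |u x| ^ 5)) = fun x => q * (|u x| ^ 5 * φ x) := by
    funext x
    ring
  rw [e1, integral_add hi1 hi2, integral_const_mul, integral_const_mul] at hA
  rw [e2, integral_const_mul] at hC
  rw [energyF, hC, hA]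
  ring
end
end
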